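/- arXiv:quant-ph/0004036 — 3 statements merged into one kernel-verified Lean document; each statement's English description precedes it below -/
import Mathlib

section
/- Every positive operator x in B(H) on a Hilbert space H can be written as x = ‖x‖ · Σ_{j=1}^∞ (1/2^j) p_j, where {p_j} is a sequence of pairwise commuting (orthogonal) projections on H, with the series converging in norm. -/
/-- Right annihilators of a single element of `B(H)` are generated by star projections. -/
theorem ContinuousLinearMap.exists_isStarProjection_mul_eq_zero_iff
    {H : Type*} [NormedAddCommGroup H] [InnerProductSpace ℂ H] [CompleteSpace H]
    (c : H →L[ℂ] H) :
    ∃ q : H →L[ℂ] H, IsStarProjection q ∧ ∀ z : H →L[ℂ] H, c * z = 0 ↔ q * z = z := by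
  have : CompleteSpace c.ker := c.isClosed_ker.completeSpace_coe
  refine ⟨c.ker.starProjection, isStarProjection_starProjection, fun z => ?_⟩
  simp only [ContinuousLinearMap.ext_iff, mul_apply_eq_comp,
    Submodule.starProjection_eq_self_iff]
  rfl

/-- If `q` is a star projection generating the right annihilator of `c`, then `q` commutes with
every `b` such that both `b` and `star b` commute with `c`. -/
theorem IsStarProjection.commute_of_mul_eq_zero_iff {A : Type*} [Ring A] [StarRing A]
    {c q b : A} (hq : IsStarProjection q) (h : ∀ z, c * z = 0 ↔ q * z = z)
    (hb : Commute c b) (hb' : Commute c (star b)) : Commute q b := by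
  have hcq : c * q = 0 := (h q).2 hq.isIdempotentElem
  have key : ∀ d, Commute c d → q * (d * q) = d * q := fun d hd =>
    (h _).1 (by rw [← mul_assoc, hd.eq, mul_assoc, hcq, mul_zero])
  have h₁ := key b hb
  have h₂ := congrArg star (key (star b) hb')
  simp only [star_mul, star_star, hq.isSelfAdjoint.star_eq] at h₂
  rw [commute_iff_eq, ← h₁, ← h₂, mul_assoc]

/-- The leading binary digit of an operator `0 ≤ y ≤ 1`: a star projection `p` in the bicommutant
of `y` with `0 ≤ 2 y - p ≤ 1`. -/
theorem ContinuousLinearMap.exists_leading_binary_digit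
    {H : Type*} [NormedAddCommGroup H] [InnerProductSpace ℂ H] [CompleteSpace H]
    {y : H →L[ℂ] H} (h0 : 0 ≤ y) (h1 : y ≤ 1) :
    ∃ p : H →L[ℂ] H, IsStarProjection p ∧ (∀ b, Commute y b → Commute p b) ∧
      0 ≤ y + y - p ∧ y + y - p ≤ 1 := by
  have hy : IsSelfAdjoint y := .of_nonneg h0
  set a := y + y - 1 with ha_def
  have ha : IsSelfAdjoint a := (hy.add hy).sub (.one _)
  have hsub : a⁺ - a⁻ = a := CFC.posPart_sub_negPart a ha
  obtain ⟨q, hq, h⟩ := exists_isStarProjection_mul_eq_zero_iff a⁺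
  have hcomm : ∀ b, Commute y b → Commute q b := by
    intro b hb
    have hpos : ∀ d, Commute y d → Commute a⁺ d := fun d hd =>
      ((hd.add_left hd).sub_left (Commute.one_left d)).cfcₙ_real _
    refine hq.commute_of_mul_eq_zero_iff h (hpos b hb) (hpos _ ?_)
    simpa [hy.star_eq] using hb.star_star
  have hqy : y * q = q * y := (hcomm y rfl).eq.symm
  have hqq : q * q = q := hq.isIdempotentElem
  have hcq : a⁺ * q = 0 := (h q).2 hqq
  have hqn : q * a⁻ = a⁻ := (h _).1 (CFC.posPart_mul_negPart a)
  have hnq : a⁻ * q = a⁻ := by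
    have := congrArg star hqn
    rwa [star_mul, hq.isSelfAdjoint.star_eq,
      (IsSelfAdjoint.of_nonneg (CFC.negPart_nonneg a)).star_eq] at this
  have haq : a * q = -a⁻ := by
    calc a * q = (a⁺ - a⁻) * q := by rw [hsub]
      _ = -a⁻ := by rw [sub_mul, hcq, hnq, zero_sub]
  have hyq : y * q + y * q - q = -a⁻ := by
    rw [← haq, ha_def, sub_mul, add_mul, one_mul]
  have hp : IsStarProjection (1 - q) := hq.one_sub
  refine ⟨1 - q, hp, fun b hb => (Commute.one_left b).sub_left (hcomm b hb), ?_, ?_⟩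
  · have hc : 0 ≤ q * (y + y) * q := hq.isSelfAdjoint.conjugate_nonneg (add_nonneg h0 h0)
    have e : y + y - (1 - q) = a⁺ + q * (y + y) * q := by
      have e₁ : q * (y + y) * q = y * q + y * q := by
        rw [mul_add, ← hqy, add_mul, mul_assoc, hqq]
      rw [e₁, sub_eq_iff_eq_add.1 hsub, ← neg_eq_iff_eq_neg.2 hyq, ha_def]
      abel
    rw [e]
    exact add_nonneg (CFC.posPart_nonneg a) hc
  · have hc : 0 ≤ (1 - q) * ((1 - y) + (1 - y)) * (1 - q) :=
      hp.isSelfAdjoint.conjugate_nonneg (add_nonneg (sub_nonneg.2 h1) (sub_nonneg.2 h1))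
    have e : 1 - (y + y - (1 - q)) = a⁻ + (1 - q) * ((1 - y) + (1 - y)) * (1 - q) := by
      have e₁ : (1 - q) * ((1 - y) + (1 - y)) * (1 - q)
          = (1 - y) + (1 - y) - (q + q) + (y * q + y * q) := by
        have e₂ : (1 - q) * (1 - q) = 1 - q := hp.isIdempotentElem
        have e₃ : (1 - q) * ((1 - y) + (1 - y)) = ((1 - y) + (1 - y)) * (1 - q) := by
          simp only [mul_add, add_mul, mul_sub, sub_mul, one_mul, mul_one, hqy]
          abel
        rw [e₃, mul_assoc, e₂]
        simp only [add_mul, mul_sub, sub_mul, one_mul, mul_one]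
        abel
      rw [e₁, ← neg_eq_iff_eq_neg.2 hyq]
      abel
    rw [← sub_nonneg, e]
    exact add_nonneg (CFC.negPart_nonneg a) hc

/-- Every operator `0 ≤ y ≤ 1` has a binary expansion whose digits are star projections in the
bicommutant of `y`. -/
theorem ContinuousLinearMap.exists_binary_expansion
    {H : Type*} [NormedAddCommGroup H] [InnerProductSpace ℂ H] [CompleteSpace H]
    {y : H →L[ℂ] H} (h0 : 0 ≤ y) (h1 : y ≤ 1) :
    ∃ p : ℕ → H →L[ℂ] H, (∀ j, IsStarProjection (p j)) ∧
      (∀ j b, Commute y b → Commute (p j) b) ∧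
      HasSum (fun j : ℕ => ((1 : ℝ) / 2 ^ (j + 1)) • p j) y := by
  choose d hd hdc hd0 hd1 using
    fun z : {z : H →L[ℂ] H // 0 ≤ z ∧ z ≤ 1} => exists_leading_binary_digit z.2.1 z.2.2
  let r : ℕ → {z : H →L[ℂ] H // 0 ≤ z ∧ z ≤ 1} := fun n =>
    n.rec ⟨y, h0, h1⟩ fun _ z => ⟨z + z - d z, hd0 z, hd1 z⟩
  have hr : ∀ n, (r (n + 1)).1 = (r n).1 + (r n).1 - d (r n) := fun _ => rfl
  have hrc : ∀ n b, Commute y b → Commute (r n).1 b := by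
    intro n b hb
    induction n with
    | zero => exact hb
    | succ n ih =>
      rw [hr]
      exact (ih.add_left ih).sub_left (hdc _ b ih)
  have hpartial : ∀ n, ∑ j ∈ Finset.range n, ((1 : ℝ) / 2 ^ (j + 1)) • d (r j)
      = y - ((1 : ℝ) / 2) ^ n • (r n).1 := by
    intro n
    induction n with
    | zero => simp [r]
    | succ n ih =>
      rw [Finset.sum_range_succ, ih, hr, one_div_pow, one_div_pow, pow_succ]
      module
  have hgeom : Summable fun j : ℕ => ((1 : ℝ) / 2) ^ j := summable_geometric_two
  refine ⟨fun j => d (r j), fun j => hd _, fun j b hb => hdc _ b (hrc j b hb), ?_⟩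
  rw [hasSum_iff_tendsto_nat_of_summable_norm]
  · simp only [hpartial]
    have hlim : Filter.Tendsto (fun n => ((1 : ℝ) / 2) ^ n • (r n).1)
        Filter.atTop (nhds 0) := by
      refine squeeze_zero_norm (fun n => ?_) hgeom.tendsto_atTop_zero
      have hn : ‖(r n).1‖ ≤ 1 :=
        (CStarAlgebra.norm_le_one_iff_of_nonneg _ (r n).2.1).2 (r n).2.2
      rw [norm_smul, Real.norm_of_nonneg (by positivity)]
      exact mul_le_of_le_one_right (by positivity) hn
    simpa using tendsto_const_nhds.sub hlim
  · refine ((summable_nat_add_iff 1).2 hgeom).of_nonneg_of_le (fun _ => norm_nonneg _) fun j => ?_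
    rw [norm_smul, Real.norm_of_nonneg (by positivity), one_div_pow]
    exact mul_le_of_le_one_right (by positivity) (hd _).norm_le

/-- Every positive operator `x` on a complex Hilbert space `H` can be written as
`x = ‖x‖ • ∑_{j=1}^∞ (1/2^j) • p j`, where the `p j` are pairwise commuting
orthogonal projections (self-adjoint idempotents), the series converging in
operator norm. -/
theorem positive_operator_dyadic_decomposition
    {H : Type*} [NormedAddCommGroup H] [InnerProductSpace ℂ H] [CompleteSpace H]
    (x : H →L[ℂ] H) (hx : x.IsPositive) :
    ∃ p : ℕ → H →L[ℂ] H,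
      (∀ j, IsIdempotentElem (p j) ∧ IsSelfAdjoint (p j)) ∧
      (∀ j k, Commute (p j) (p k)) ∧
      ∃ s : H →L[ℂ] H,
        HasSum (fun j : ℕ => ((1 : ℝ) / 2 ^ (j + 1)) • p j) s ∧ x = ‖x‖ • s := by
  have hx0 : 0 ≤ x := ContinuousLinearMap.nonneg_iff_isPositive x |>.2 hx
  have h0 : 0 ≤ ‖x‖⁻¹ • x := smul_nonneg (by positivity) hx0
  have h1 : ‖x‖⁻¹ • x ≤ 1 := by
    refine (CStarAlgebra.norm_le_one_iff_of_nonneg _ h0).1 ?_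
    rw [norm_smul, norm_inv, norm_norm]
    exact inv_mul_le_one
  obtain ⟨p, hp, hpc, hsum⟩ := ContinuousLinearMap.exists_binary_expansion h0 h1
  refine ⟨p, fun j => ⟨(hp j).isIdempotentElem, (hp j).isSelfAdjoint⟩,
    fun j k => hpc j _ (hpc k _ rfl).symm, _, hsum, ?_⟩
  rcases eq_or_ne x 0 with rfl | hne
  · simp
  · rw [smul_inv_smul₀ (norm_ne_zero_iff.2 hne)]
end

section
/- Let H₁,…,Hₙ be finite dimensional complex Hilbert spaces. Every quantum multi-measure m : P(H₁) × ⋯ × P(Hₙ) → ℝ≥0 (separately orthoadditive in each variable, with each Hilbert space of dimension ≠ 2) extends uniquely to a multilinear map M : B(H₁) × ⋯ × B(Hₙ) → ℂ agreeing with m on tuples of projections. -/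
/-- orthogonal projection (self-adjoint idempotent). -/
def IsProjectionOp {H : Type*} [NormedAddCommGroup H] [InnerProductSpace ℂ H]
    [CompleteSpace H] (e : H →L[ℂ] H) : Prop :=
  IsIdempotentElem e ∧ IsSelfAdjoint e

/-- A positive quantum multi-measure: nonnegative and orthoadditive in each
variable separately on tuples of projections. -/
def IsQuantumMultimeasure {n : ℕ} {H : Fin n → Type*}
    [∀ i, NormedAddCommGroup (H i)] [∀ i, InnerProductSpace ℂ (H i)]
    [∀ i, CompleteSpace (H i)]
    (m : (∀ i, H i →L[ℂ] H i) → ℝ) : Prop :=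
  (∀ p : ∀ i, H i →L[ℂ] H i, (∀ i, IsProjectionOp (p i)) → 0 ≤ m p) ∧
  ∀ (p : ∀ i, H i →L[ℂ] H i), (∀ i, IsProjectionOp (p i)) →
    ∀ (i : Fin n) (q r : H i →L[ℂ] H i),
      IsProjectionOp q → IsProjectionOp r → q * r = 0 → r * q = 0 →
      m (Function.update p i (q + r)) =
        m (Function.update p i q) + m (Function.update p i r)

open Filter Topology
open scoped Matrix

/-- A function of the lines of `ℝ³` whose values at any three mutually orthogonal lines sum to the
weight `w`. -/
structure IsFrameFunction (g : (Fin 3 → ℝ) → ℝ) (w : ℝ) : Prop where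
  smul : ∀ c : ℝ, c ≠ 0 → ∀ x, g (c • x) = g x
  frame : ∀ x y z, x ≠ 0 → y ≠ 0 → z ≠ 0 → x ⬝ᵥ y = 0 → y ⬝ᵥ z = 0 → z ⬝ᵥ x = 0 →
    g x + g y + g z = w

/-- The oscillation of `g` near `x` is at most `ε`. -/
def OscLE (g : (Fin 3 → ℝ) → ℝ) (ε : ℝ) (x : Fin 3 → ℝ) : Prop :=
  ∃ U ∈ 𝓝 x, ∀ y ∈ U, ∀ z ∈ U, |g y - g z| ≤ ε

lemma continuous_crossProduct :
    Continuous fun p : (Fin 3 → ℝ) × (Fin 3 → ℝ) => p.1 ⨯₃ p.2 := by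
  simp only [cross_apply]
  refine continuous_pi fun i => ?_
  fin_cases i <;> simp <;> fun_prop

lemma continuousAt_crossProduct {X : Type*} [TopologicalSpace X] {a b : X → Fin 3 → ℝ} {z : X}
    (ha : ContinuousAt a z) (hb : ContinuousAt b z) : ContinuousAt (fun y => a y ⨯₃ b y) z :=
  continuous_crossProduct.continuousAt.comp (ha.prodMk hb)

namespace IsFrameFunction
variable {g : (Fin 3 → ℝ) → ℝ} {w ε : ℝ}

lemma add_cross_eq (hg : IsFrameFunction g w) {n x : Fin 3 → ℝ} (hx : n ⬝ᵥ x = 0)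
    (hx0 : n ⨯₃ x ≠ 0) : g x + g (n ⨯₃ x) + g n = w := by
  refine hg.frame _ _ _ ?_ hx0 ?_ (dot_cross_self _ _) ?_ hx
  · rintro rfl; simp at hx0
  · rintro rfl; simp at hx0
  · rw [dotProduct_comm, dot_self_cross]

lemma oscLE_of_dotProduct_eq_zero (hg : IsFrameFunction g w) {x q : Fin 3 → ℝ} (hx : x ≠ 0)
    (hq : q ≠ 0) (hqx : q ⬝ᵥ x = 0) (h : OscLE g ε x) : OscLE g (2 * ε) q := by
  obtain ⟨U, hU, hUg⟩ := h
  have hqq : q ⬝ᵥ q ≠ 0 := by simpa using hq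
  have hxx : x ⬝ᵥ x ≠ 0 := by simpa using hx
  have hxq : x ⬝ᵥ q = 0 := by rwa [dotProduct_comm]
  have hV : U ∩ {0}ᶜ ∈ 𝓝 x := inter_mem hU (isOpen_compl_singleton.mem_nhds hx)
  set V := U ∩ {0}ᶜ
  set t : Fin 3 → ℝ := (q ⬝ᵥ q)⁻¹ • (q ⨯₃ x) with ht
  have htq : t ⨯₃ q = x := by
    simp [ht, cross_cross_eq_smul_sub_smul, hxq, smul_smul, hqq]
  have htx : t ⨯₃ x = -(x ⬝ᵥ x / q ⬝ᵥ q) • q := by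
    simp [ht, cross_cross_eq_smul_sub_smul, hqx, smul_smul]
    ring_nf
  have htq0 : t ⬝ᵥ q = 0 := by
    rw [dotProduct_comm]; simp [ht]
  have hc : ∀ᶠ c : ℝ in 𝓝[≠] 0, (t + c • x) ⨯₃ q ∈ interior V := by
    have : ContinuousAt (fun c : ℝ => (t + c • x) ⨯₃ q) 0 :=
      continuousAt_crossProduct (by fun_prop) continuousAt_const
    refine (this.eventually ?_).filter_mono nhdsWithin_le_nhds
    simpa [htq] using hV
  obtain ⟨c, hcV, hc0⟩ := (hc.and self_mem_nhdsWithin).exists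
  have hc0 : c ≠ 0 := hc0
  set n : (Fin 3 → ℝ) → (Fin 3 → ℝ) → (Fin 3 → ℝ) :=
    fun s y => s - (s ⬝ᵥ y / y ⬝ᵥ y) • y with hn
  set r : (Fin 3 → ℝ) × (Fin 3 → ℝ) → (Fin 3 → ℝ) := fun y =>
    (-(q ⬝ᵥ q) / (c * x ⬝ᵥ x)) • (n t y.1 ⨯₃ n (t + c • x) y.2) with hr
  have hnq : ∀ s, s ⬝ᵥ q = 0 → n s q = s := by intro s hs; simp [hn, hs]
  have hn0 : ∀ s y, n s y ⬝ᵥ y = 0 := by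
    intro s y
    rcases eq_or_ne y 0 with rfl | hy
    · simp
    have : y ⬝ᵥ y ≠ 0 := by simpa using hy
    simp [hn, sub_dotProduct, this]
  have hs2 : (t + c • x) ⬝ᵥ q = 0 := by simp [add_dotProduct, htq0, hxq]
  have hrq : r (q, q) = q := by
    simp only [hr, hnq _ htq0, hnq _ hs2]
    rw [map_add, cross_self, zero_add, map_smul, htx, smul_smul, smul_smul]
    convert one_smul ℝ q
    field_simp
  have hncont : ∀ s, ContinuousAt (n s) q := by
    intro s
    refine continuousAt_const.sub (ContinuousAt.smul (ContinuousAt.div (f := fun y => s ⬝ᵥ y)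
      (g := fun y => y ⬝ᵥ y) ?_ ?_ hqq) continuousAt_id)
    · exact (continuous_const.dotProduct continuous_id).continuousAt
    · exact (continuous_id.dotProduct continuous_id).continuousAt
  clear_value n
  have hn1 : ContinuousAt (fun y : (Fin 3 → ℝ) × (Fin 3 → ℝ) => n t y.1) (q, q) :=
    ContinuousAt.comp (x := (q, q)) (hncont t) continuousAt_fst
  have hn2 : ContinuousAt (fun y : (Fin 3 → ℝ) × (Fin 3 → ℝ) => n (t + c • x) y.2) (q, q) :=
    ContinuousAt.comp (x := (q, q)) (hncont _) continuousAt_snd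
  have hrc : ContinuousAt r (q, q) := by
    rw [hr]
    exact (continuousAt_crossProduct hn1 hn2).const_smul (-(q ⬝ᵥ q) / (c * x ⬝ᵥ x))
  have key : ∀ᶠ y : (Fin 3 → ℝ) × (Fin 3 → ℝ) in 𝓝 (q, q), |g y.1 - g y.2| ≤ 2 * ε := by
    have e1 := (continuousAt_crossProduct hn1 continuousAt_fst).eventually_mem
      (s := interior V) (isOpen_interior.mem_nhds (by
        simpa only [hnq _ htq0, htq] using mem_interior_iff_mem_nhds.2 hV))
    have e2 := (continuousAt_crossProduct hn1 hrc).eventually_mem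
      (s := interior V) (isOpen_interior.mem_nhds (by
        simpa only [hrq, hnq _ htq0, htq] using mem_interior_iff_mem_nhds.2 hV))
    have e3 := (continuousAt_crossProduct hn2 continuousAt_snd).eventually_mem
      (s := interior V) (isOpen_interior.mem_nhds (by simpa only [hnq _ hs2] using hcV))
    have e4 := (continuousAt_crossProduct hn2 hrc).eventually_mem
      (s := interior V) (isOpen_interior.mem_nhds (by simpa only [hrq, hnq _ hs2] using hcV))
    filter_upwards [e1, e2, e3, e4] with y h1 h2 h3 h4
    replace h1 := interior_subset h1
    replace h2 := interior_subset h2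
    replace h3 := interior_subset h3
    replace h4 := interior_subset h4
    have hr1 : n t y.1 ⬝ᵥ r y = 0 := by simp [hr]
    have hr2 : n (t + c • x) y.2 ⬝ᵥ r y = 0 := by simp [hr]
    have a1 := hg.add_cross_eq (hn0 t y.1) h1.2
    have a2 := hg.add_cross_eq hr1 h2.2
    have a3 := hg.add_cross_eq (hn0 _ y.2) h3.2
    have a4 := hg.add_cross_eq hr2 h4.2
    have b1 := abs_le.1 (hUg _ h1.1 _ h2.1)
    have b2 := abs_le.1 (hUg _ h3.1 _ h4.1)
    rw [abs_le]
    constructor <;> linarith [b1.1, b1.2, b2.1, b2.2]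
  rw [nhds_prod_eq, eventually_prod_self_iff'] at key
  obtain ⟨W, hW, hWg⟩ := key
  exact ⟨W, hW, fun y hy z hz => hWg y hy z hz⟩


lemma exists_ne_zero_dotProduct_eq_zero (x y : Fin 3 → ℝ) :
    ∃ q : Fin 3 → ℝ, q ≠ 0 ∧ q ⬝ᵥ x = 0 ∧ q ⬝ᵥ y = 0 := by
  obtain ⟨q, hq, h⟩ := (Matrix.exists_mulVec_eq_zero_iff (M := Matrix.of ![x, y, 0])).2
    (Matrix.det_eq_zero_of_row_eq_zero 2 (by simp))
  refine ⟨q, hq, ?_, ?_⟩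
  · simpa [Matrix.mulVec, dotProduct_comm] using congrFun h 0
  · simpa [Matrix.mulVec, dotProduct_comm] using congrFun h 1

lemma oscLE_of_ne_zero (hg : IsFrameFunction g w) {x y : Fin 3 → ℝ} (hx : x ≠ 0)
    (hy : y ≠ 0) (h : OscLE g ε x) : OscLE g (4 * ε) y := by
  obtain ⟨q, hq, hqx, hqy⟩ := exists_ne_zero_dotProduct_eq_zero x y
  convert hg.oscLE_of_dotProduct_eq_zero hq hy (by rwa [dotProduct_comm])
    (hg.oscLE_of_dotProduct_eq_zero hx hq hqx h) using 1
  ring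

lemma comp (hg : IsFrameFunction g w) (L : (Fin 3 → ℝ) →ₗ[ℝ] (Fin 3 → ℝ))
    (hL : ∀ x y, L x ⬝ᵥ L y = x ⬝ᵥ y) : IsFrameFunction (g ∘ L) w := by
  have h0 : ∀ x, x ≠ 0 → L x ≠ 0 := fun x hx h => hx <| by
    have := hL x x
    rwa [h, zero_dotProduct, eq_comm, dotProduct_self_eq_zero] at this
  refine ⟨fun c hc x => by simp [hg.smul c hc], fun x y z hx hy hz hxy hyz hzx => ?_⟩
  exact hg.frame _ _ _ (h0 x hx) (h0 y hy) (h0 z hz) (by rwa [hL]) (by rwa [hL]) (by rwa [hL])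

lemma add (hg : IsFrameFunction g w) {g' : (Fin 3 → ℝ) → ℝ} {w' : ℝ}
    (hg' : IsFrameFunction g' w') : IsFrameFunction (g + g') (w + w') := by
  refine ⟨fun c hc x => by simp [hg.smul c hc, hg'.smul c hc],
    fun x y z hx hy hz hxy hyz hzx => ?_⟩
  have := hg.frame x y z hx hy hz hxy hyz hzx
  have := hg'.frame x y z hx hy hz hxy hyz hzx
  simp only [Pi.add_apply]
  linarith

/-- Subtracting a constant from a frame function. -/
lemma sub_const (hg : IsFrameFunction g w) (c : ℝ) :
    IsFrameFunction (fun x => g x - c) (w - 3 * c) := by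
  refine ⟨fun a ha x => by simp [hg.smul a ha], fun x y z hx hy hz hxy hyz hzx => ?_⟩
  linarith [hg.frame x y z hx hy hz hxy hyz hzx]

end IsFrameFunction

/-- Any two vectors of the same length are exchanged by an isometric involution. -/
lemma exists_isometric_involution {p q : Fin 3 → ℝ} (hpq : p ⬝ᵥ p = q ⬝ᵥ q) :
    ∃ L : (Fin 3 → ℝ) →ₗ[ℝ] (Fin 3 → ℝ),
      (∀ x y, L x ⬝ᵥ L y = x ⬝ᵥ y) ∧ (∀ x, L (L x) = x) ∧ L p = q := by
  rcases eq_or_ne p q with rfl | hne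
  · exact ⟨LinearMap.id, by simp, by simp, by simp⟩
  set v := p - q with hv
  have hvv : v ⬝ᵥ v ≠ 0 := by
    rwa [ne_eq, dotProduct_self_eq_zero, sub_eq_zero]
  let L : (Fin 3 → ℝ) →ₗ[ℝ] (Fin 3 → ℝ) :=
    { toFun := fun x => x - (2 * (v ⬝ᵥ x) / (v ⬝ᵥ v)) • v
      map_add' := fun x y => by
        simp only [dotProduct_add, mul_add, add_div, add_smul]; abel
      map_smul' := fun c x => by
        simp only [dotProduct_smul, smul_sub, smul_smul, RingHom.id_apply, smul_eq_mul]
        ring_nf }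
  have hL : ∀ x, L x = x - (2 * (v ⬝ᵥ x) / (v ⬝ᵥ v)) • v := fun _ => rfl
  refine ⟨L, fun x y => ?_, fun x => ?_, ?_⟩
  · simp only [hL, sub_dotProduct, dotProduct_sub, smul_dotProduct, dotProduct_smul, smul_eq_mul,
      dotProduct_comm x v]
    field_simp
    ring
  · simp only [hL, dotProduct_sub, dotProduct_smul, smul_eq_mul, sub_sub, ← add_smul]
    convert sub_zero x
    convert zero_smul ℝ v
    field_simp
    ring
  · have : 2 * (v ⬝ᵥ p) = v ⬝ᵥ v := by
      simp only [hv, sub_dotProduct, dotProduct_sub, dotProduct_comm q p]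
      linarith
    rw [hL, this, div_self hvv, one_smul, hv, sub_sub_cancel]

lemma fin_three_eta (x : Fin 3 → ℝ) : ![x 0, x 1, x 2] = x := by
  ext i; fin_cases i <;> rfl

lemma vec_ne_zero_of_sq {a b : ℝ} (h : 0 < a ^ 2 + b ^ 2) (z : ℝ) :
    (![a, b, z] : Fin 3 → ℝ) ≠ 0 := by
  intro h0
  have h1 := congrFun h0 0
  have h2 := congrFun h0 1
  simp at h1 h2
  simp [h1, h2] at h

/-- The quarter turn about the third axis. -/
def quarterTurn : (Fin 3 → ℝ) →ₗ[ℝ] (Fin 3 → ℝ) where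
  toFun x := ![-x 1, x 0, x 2]
  map_add' x y := by ext i; fin_cases i <;> simp [add_comm]
  map_smul' c x := by ext i; fin_cases i <;> simp

lemma quarterTurn_apply (x : Fin 3 → ℝ) : quarterTurn x = ![-x 1, x 0, x 2] := rfl

namespace IsFrameFunction
variable {g : (Fin 3 → ℝ) → ℝ} {w ε δ c : ℝ}

lemma apply_le_of_equator (hg : IsFrameFunction g w) (h0 : ∀ x, 0 ≤ g x)
    (hc : ∀ a b : ℝ, 0 < a ^ 2 + b ^ 2 → g ![a, b, 0] = c) {x : Fin 3 → ℝ} (hx : x ≠ 0) :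
    g x ≤ w - c := by
  obtain ⟨a, b, z, rfl⟩ : ∃ a b z, x = ![a, b, z] := ⟨_, _, _, (fin_three_eta x).symm⟩
  rcases (by positivity : 0 ≤ a ^ 2 + b ^ 2).eq_or_lt with h | h
  · have ha : a = 0 := by nlinarith [sq_nonneg a, sq_nonneg b]
    have hb : b = 0 := by nlinarith [sq_nonneg a, sq_nonneg b]
    subst ha hb
    have := hg.frame ![0, 0, z] ![1, 0, 0] ![0, 1, 0] hx (vec_ne_zero_of_sq (by norm_num) _)
      (vec_ne_zero_of_sq (by norm_num) _) (by simp) (by simp) (by simp)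
    have h1 := hc 1 0 (by norm_num)
    have h2 := h0 ![0, 1, 0]
    linarith
  · have hn : (![-b, a, 0] : Fin 3 → ℝ) ⨯₃ ![a, b, z] ≠ 0 := by
      intro h0
      have := congrFun h0 2
      simp [cross_apply] at this
      nlinarith
    have h1 := hg.add_cross_eq (by simp; ring) hn
    have h2 := hc (-b) a (by nlinarith)
    linarith [h0 ((![-b, a, 0] : Fin 3 → ℝ) ⨯₃ ![a, b, z])]

/-- Moving away from the pole `![0, 0, 1]`, perpendicularly to the radius. -/
lemma le_add_of_tangent_step (hg : IsFrameFunction g w) (h0 : ∀ x, 0 ≤ g x)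
    (hc : ∀ a b : ℝ, 0 < a ^ 2 + b ^ 2 → g ![a, b, 0] = c) {a b : ℝ} (hab : 0 < a ^ 2 + b ^ 2)
    (t : ℝ) : g ![a, b, 1] ≤ g ![a - t * b, b + t * a, 1] + (w - 2 * c) := by
  have hn : (![-a, -b, a ^ 2 + b ^ 2] : Fin 3 → ℝ) ≠ 0 := vec_ne_zero_of_sq (by nlinarith) _
  have h1 := hg.frame ![a, b, 1] ![-b, a, 0] ![-a, -b, a ^ 2 + b ^ 2] (vec_ne_zero_of_sq hab _)
    (vec_ne_zero_of_sq (by nlinarith) _) hn (by simp; ring)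
    (by simp; ring) (by simp; ring)
  have hn' : (![-a, -b, a ^ 2 + b ^ 2] : Fin 3 → ℝ) ⨯₃ ![a - t * b, b + t * a, 1] ≠ 0 := by
    intro h
    have e0 := congrFun h 0
    have e1 := congrFun h 1
    simp [cross_apply] at e0 e1
    have : (a ^ 2 + b ^ 2) * (1 + a ^ 2 + b ^ 2) = 0 := by
      linear_combination -b * e0 + a * e1
    have : 0 < (a ^ 2 + b ^ 2) * (1 + a ^ 2 + b ^ 2) := by positivity
    linarith
  have h2 := hg.add_cross_eq (by simp; ring) hn'
  have h3 := hg.apply_le_of_equator h0 hc hn'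
  have h4 := hc (-b) a (by nlinarith)
  linarith

lemma le_add_of_one_le (hg : IsFrameFunction g w) (h0 : ∀ x, 0 ≤ g x)
    (hc : ∀ a b : ℝ, 0 < a ^ 2 + b ^ 2 → g ![a, b, 0] = c) {a b : ℝ} (hab : 0 < a ^ 2 + b ^ 2)
    {α : ℝ} (hα : 1 ≤ α) (β : ℝ) :
    g ![a, b, 1] ≤ g ![α * a - β * b, α * b + β * a, 1] + 2 * (w - 2 * c) := by
  set s := √(β ^ 2 + 4 * (α - 1)) with hs
  have hs2 : s ^ 2 = β ^ 2 + 4 * (α - 1) := Real.sq_sqrt (by nlinarith [sq_nonneg β])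
  have h1 := hg.le_add_of_tangent_step h0 hc hab ((β + s) / 2)
  have hab' : 0 < (a - (β + s) / 2 * b) ^ 2 + (b + (β + s) / 2 * a) ^ 2 := by
    have : (a - (β + s) / 2 * b) ^ 2 + (b + (β + s) / 2 * a) ^ 2 =
      (1 + ((β + s) / 2) ^ 2) * (a ^ 2 + b ^ 2) := by ring
    rw [this]; positivity
  have h2 := hg.le_add_of_tangent_step h0 hc hab' ((β - s) / 2)
  have e1 : a - (β + s) / 2 * b - (β - s) / 2 * (b + (β + s) / 2 * a) = α * a - β * b := by
    linear_combination a / 4 * hs2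
  have e2 : b + (β + s) / 2 * a + (β - s) / 2 * (a - (β + s) / 2 * b) = α * b + β * a := by
    linear_combination b / 4 * hs2
  rw [e1, e2] at h2
  linarith

lemma exists_oscLE (hg : IsFrameFunction g w) (h0 : ∀ x, 0 ≤ g x)
    (hc : ∀ a b : ℝ, 0 < a ^ 2 + b ^ 2 → g ![a, b, 0] = c) (hδ : 0 < δ) :
    ∃ x : Fin 3 → ℝ, x ≠ 0 ∧ OscLE g (2 * (w - 2 * c) + δ) x := by
  set S : Set ℝ := {r | ∃ a b : ℝ, 0 < a ^ 2 + b ^ 2 ∧ g ![a, b, 1] = r} with hS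
  have hSb : BddAbove S := by
    refine ⟨w - c, ?_⟩
    rintro _ ⟨a, b, hab, rfl⟩
    exact hg.apply_le_of_equator h0 hc (vec_ne_zero_of_sq hab _)
  obtain ⟨_, ⟨a, b, hab, rfl⟩, hlt⟩ := exists_lt_of_lt_csSup
    (⟨_, 1, 0, by norm_num, rfl⟩ : S.Nonempty) (sub_lt_self (sSup S) hδ)
  refine ⟨![2 * a, 2 * b, 1], vec_ne_zero_of_sq (by nlinarith) _,
    {x | 0 < x 2 ∧ x 2 * (a ^ 2 + b ^ 2) < a * x 0 + b * x 1}, ?_, ?_⟩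
  · refine IsOpen.mem_nhds ?_ ?_
    · exact (isOpen_lt continuous_const (continuous_apply 2)).inter
        (isOpen_lt (f := fun x : Fin 3 → ℝ => x 2 * (a ^ 2 + b ^ 2))
          (g := fun x => a * x 0 + b * x 1) (by fun_prop) (by fun_prop))
    · simp; nlinarith
  have key : ∀ x : Fin 3 → ℝ, 0 < x 2 ∧ x 2 * (a ^ 2 + b ^ 2) < a * x 0 + b * x 1 →
      sSup S - δ - 2 * (w - 2 * c) ≤ g x ∧ g x ≤ sSup S := by
    rintro x ⟨hx, hlt'⟩
    set α := (a * x 0 + b * x 1) / (x 2 * (a ^ 2 + b ^ 2)) with hα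
    set β := (a * x 1 - b * x 0) / (x 2 * (a ^ 2 + b ^ 2)) with hβ
    have hα1 : 1 ≤ α := by
      rw [hα, one_le_div (by positivity)]; exact hlt'.le
    have hx' : g x = g ![α * a - β * b, α * b + β * a, 1] := by
      rw [← hg.smul (x 2)⁻¹ (by positivity)]
      congr 1
      ext i
      fin_cases i
      · simp [hα, hβ]; field_simp; ring
      · simp [hα, hβ]; field_simp; ring
      · simp [hx.ne']
    have h1 := hg.le_add_of_one_le h0 hc hab hα1 β
    rw [hx']
    refine ⟨by linarith, le_csSup hSb ⟨_, _, ?_, rfl⟩⟩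
    have : (α * a - β * b) ^ 2 + (α * b + β * a) ^ 2 = (α ^ 2 + β ^ 2) * (a ^ 2 + b ^ 2) := by ring
    rw [this]; positivity
  intro y hy z hz
  have h1 := key y hy
  have h2 := key z hz
  rw [abs_le]
  constructor <;> linarith [h1.1, h1.2, h2.1, h2.2]

lemma oscLE_pole (hg : IsFrameFunction g w) (h0 : ∀ x, 0 ≤ g x) (hδ : 0 < δ)
    (hp : g ![0, 0, 1] ≤ δ) : OscLE g (22 * δ) ![0, 0, 1] := by
  have hp0 : (![0, 0, 1] : Fin 3 → ℝ) ≠ 0 := fun h => by simpa using congrFun h 2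
  set G := g + g ∘ quarterTurn with hGdef
  have hG : IsFrameFunction G (w + w) := hg.add (hg.comp quarterTurn fun x y => by
    simp [quarterTurn_apply, Matrix.vec3_dotProduct]; ring)
  have hG0 : ∀ x, 0 ≤ G x := fun x => add_nonneg (h0 _) (h0 _)
  have hGc : ∀ a b : ℝ, 0 < a ^ 2 + b ^ 2 → G ![a, b, 0] = w - g ![0, 0, 1] := by
    intro a b hab
    have := hg.frame ![a, b, 0] ![-b, a, 0] ![0, 0, 1] (vec_ne_zero_of_sq hab _)
      (vec_ne_zero_of_sq (by nlinarith) _) hp0 (by simp; ring) (by simp)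
      (by simp)
    simp [hGdef, quarterTurn_apply]
    linarith
  have hGp : G ![0, 0, 1] = 2 * g ![0, 0, 1] := by
    simp [hGdef, quarterTurn_apply]; ring
  obtain ⟨x, hx, hosc⟩ := hG.exists_oscLE hG0 hGc hδ
  obtain ⟨U, hU, hUG⟩ := hG.oscLE_of_ne_zero hx hp0 hosc
  refine ⟨U, hU, fun y hy z hz => ?_⟩
  have hb : ∀ y ∈ U, 0 ≤ g y ∧ g y ≤ 22 * δ := by
    intro y hy
    have h1 := (abs_le.1 (hUG y hy _ (mem_of_mem_nhds hU))).2
    have h2 : g y ≤ G y := le_add_of_nonneg_right (h0 _)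
    exact ⟨h0 y, by linarith⟩
  have h1 := hb y hy
  have h2 := hb z hz
  rw [abs_le]
  constructor <;> linarith [h1.1, h1.2, h2.1, h2.2]

lemma congr (hg : IsFrameFunction g w) {g' : (Fin 3 → ℝ) → ℝ} (h : ∀ x, x ≠ 0 → g' x = g x) :
    IsFrameFunction g' w := by
  refine ⟨fun c hc x => ?_, fun x y z hx hy hz hxy hyz hzx => ?_⟩
  · rcases eq_or_ne x 0 with rfl | hx
    · simp
    · rw [h _ (smul_ne_zero hc hx), h x hx, hg.smul c hc]
  · rw [h x hx, h y hy, h z hz, hg.frame x y z hx hy hz hxy hyz hzx]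

lemma oscLE_of_apply_le (hg : IsFrameFunction g w) (h0 : ∀ x, 0 ≤ g x) (hδ : 0 < δ)
    {p x : Fin 3 → ℝ} (hp : p ≠ 0) (hpδ : g p ≤ δ) (hx : x ≠ 0) : OscLE g (88 * δ) x := by
  have hpp : 0 < p ⬝ᵥ p :=
    lt_of_le_of_ne (by simp only [dotProduct]; exact Finset.sum_nonneg fun i _ => mul_self_nonneg _)
      (Ne.symm (by simpa using hp))
  obtain ⟨L, hL, hLL, hLp⟩ := exists_isometric_involution
    (p := √(p ⬝ᵥ p) • ![0, 0, 1]) (q := p) (by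
      simp [Matrix.vec3_dotProduct ![(0 : ℝ), _, _], Real.mul_self_sqrt hpp.le])
  have hs : √(p ⬝ᵥ p) ≠ 0 := (Real.sqrt_pos.2 hpp).ne'
  have hpole : (g ∘ L) ![0, 0, 1] ≤ δ := by
    rwa [← (hg.comp L hL).smul _ hs, Function.comp, hLp]
  obtain ⟨U, hU, hUg⟩ := (hg.comp L hL).oscLE_pole (fun x => h0 _) hδ hpole
  have hosc : OscLE g (22 * δ) (L ![0, 0, 1]) := by
    refine ⟨L ⁻¹' U, L.continuous_of_finiteDimensional.continuousAt.preimage_mem_nhds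
      (by rwa [hLL]), fun y hy z hz => ?_⟩
    simpa [hLL] using hUg _ hy _ hz
  have hne : L ![0, 0, 1] ≠ 0 := by
    intro h
    have := hLp
    rw [map_smul, h, smul_zero] at this
    exact hp this.symm
  convert hg.oscLE_of_ne_zero hne hx hosc using 1
  ring

/-- A nonnegative frame function is continuous away from the origin. -/
theorem continuousAt (hg : IsFrameFunction g w) (h0 : ∀ x, 0 ≤ g x) {x : Fin 3 → ℝ}
    (hx : x ≠ 0) : ContinuousAt g x := by
  set m := sInf (g '' {0}ᶜ) with hm
  have hbdd : BddBelow (g '' {0}ᶜ) := ⟨0, by rintro _ ⟨y, -, rfl⟩; exact h0 y⟩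
  have hg' : IsFrameFunction (fun y => |g y - m|) (w - 3 * m) :=
    (hg.sub_const m).congr fun y hy =>
      abs_of_nonneg (sub_nonneg.2 (csInf_le hbdd ⟨y, hy, rfl⟩))
  rw [Metric.continuousAt_iff']
  intro ε hε
  obtain ⟨_, ⟨p, hp, rfl⟩, hlt⟩ := exists_lt_of_csInf_lt (s := g '' {0}ᶜ) ⟨_, x, hx, rfl⟩
    (lt_add_of_pos_right m (by positivity : 0 < ε / 89))
  have hpm : m ≤ g p := csInf_le hbdd ⟨p, hp, rfl⟩
  obtain ⟨U, hU, hUg⟩ := hg'.oscLE_of_apply_le (fun _ => abs_nonneg _)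
    (by positivity : 0 < ε / 89) hp (by rw [abs_of_nonneg] <;> linarith) hx
  filter_upwards [hU, isOpen_compl_singleton.mem_nhds hx] with y hy hy0
  have h1 := hUg y hy x (mem_of_mem_nhds hU)
  have hym : m ≤ g y := csInf_le hbdd ⟨y, hy0, rfl⟩
  have hxm : m ≤ g x := csInf_le hbdd ⟨x, hx, rfl⟩
  beta_reduce at h1
  rw [abs_of_nonneg (sub_nonneg.2 hym), abs_of_nonneg (sub_nonneg.2 hxm)] at h1
  rw [Real.dist_eq]
  have : g y - m - (g x - m) = g y - g x := by ring
  rw [this] at h1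
  linarith

end IsFrameFunction

/-- Continuous solutions of Cauchy's functional equation on the unit interval are linear. -/
lemma eq_mul_of_add_of_continuousOn_Icc {d : ℝ → ℝ} (hd : ContinuousOn d (Set.Icc 0 1))
    (hadd : ∀ a b, 0 ≤ a → 0 ≤ b → a + b ≤ 1 → d (a + b) = d a + d b) {s : ℝ}
    (hs : s ∈ Set.Icc (0 : ℝ) 1) : d s = s * d 1 := by
  set h : ℝ → ℝ := fun s => |d s - s * d 1| with hh
  have hc : ContinuousOn h (Set.Icc 0 1) := (hd.sub (by fun_prop)).abs
  obtain ⟨t, ht, hmax⟩ := isCompact_Icc.exists_isMaxOn (Set.nonempty_Icc.2 zero_le_one) hc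
  have hdouble : ∀ r ∈ Set.Icc (0 : ℝ) (1 / 2), h (2 * r) = 2 * h r := by
    intro r hr
    have := hadd r r hr.1 hr.1 (by linarith [hr.2])
    rw [← two_mul] at this
    simp only [hh, this]
    rw [← abs_two, ← abs_mul, abs_two]
    ring_nf
  have hsymm : h (1 - t) = h t := by
    have := hadd t (1 - t) ht.1 (by linarith [ht.2]) (by linarith)
    rw [add_sub_cancel] at this
    simp only [hh]
    rw [← abs_neg]
    congr 1
    linear_combination this
  have hle : ∀ r ∈ Set.Icc (0 : ℝ) (1 / 2), h r = h t → h t ≤ 0 := by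
    intro r hr hrt
    have h1 := hdouble r hr
    have h2 : h (2 * r) ≤ h t := hmax (Set.mem_Icc.2 ⟨by linarith [hr.1], by linarith [hr.2]⟩)
    linarith
  have ht0 : h t ≤ 0 := by
    rcases le_total t (1 / 2) with h1 | h1
    · exact hle t ⟨ht.1, h1⟩ rfl
    · exact hle (1 - t) ⟨by linarith [ht.2], by linarith⟩ hsymm
  have hs0 : h s ≤ 0 := (hmax hs).trans ht0
  exact sub_eq_zero.1 (abs_nonpos_iff.1 hs0)

/-- Continuous functions on `ℝ³`, homogeneous of degree two, whose values at the vectors of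
any orthonormal basis sum to zero. -/
structure IsTracelessFrame (F : (Fin 3 → ℝ) → ℝ) : Prop where
  continuous : Continuous F
  smul : ∀ (c : ℝ) x, F (c • x) = c ^ 2 * F x
  frame : ∀ x y z, x ⬝ᵥ x = 1 → y ⬝ᵥ y = 1 → z ⬝ᵥ z = 1 →
    x ⬝ᵥ y = 0 → y ⬝ᵥ z = 0 → z ⬝ᵥ x = 0 → F x + F y + F z = 0

/-- The rotation by the angle `θ` about the third axis. -/
noncomputable def axisRotation (θ : ℝ) : (Fin 3 → ℝ) →ₗ[ℝ] (Fin 3 → ℝ) where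
  toFun x := ![Real.cos θ * x 0 - Real.sin θ * x 1, Real.sin θ * x 0 + Real.cos θ * x 1, x 2]
  map_add' x y := by ext i; fin_cases i <;> simp <;> ring
  map_smul' c x := by ext i; fin_cases i <;> simp <;> ring

lemma axisRotation_apply (θ : ℝ) (x : Fin 3 → ℝ) : axisRotation θ x =
    ![Real.cos θ * x 0 - Real.sin θ * x 1, Real.sin θ * x 0 + Real.cos θ * x 1, x 2] := rfl

lemma axisRotation_add (θ φ : ℝ) (x : Fin 3 → ℝ) :
    axisRotation (θ + φ) x = axisRotation θ (axisRotation φ x) := by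
  ext i
  fin_cases i <;> simp [axisRotation_apply, Real.cos_add, Real.sin_add] <;> ring

lemma axisRotation_dotProduct (θ : ℝ) (x y : Fin 3 → ℝ) :
    axisRotation θ x ⬝ᵥ axisRotation θ y = x ⬝ᵥ y := by
  rw [Matrix.vec3_dotProduct, Matrix.vec3_dotProduct]
  simp only [axisRotation_apply, Matrix.cons_val]
  linear_combination (x 0 * y 0 + x 1 * y 1) * Real.sin_sq_add_cos_sq θ

lemma continuous_axisRotation :
    Continuous fun p : ℝ × (Fin 3 → ℝ) => axisRotation p.1 p.2 := by
  simp only [axisRotation_apply]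
  refine continuous_pi fun i => ?_
  fin_cases i <;> simp <;> fun_prop

lemma continuous_uncurry_comp_axisRotation {F : (Fin 3 → ℝ) → ℝ} (hF : Continuous F) :
    Continuous fun p : (Fin 3 → ℝ) × ℝ => F (axisRotation p.2 p.1) := by
  have h : Continuous fun p : (Fin 3 → ℝ) × ℝ => axisRotation p.2 p.1 :=
    Continuous.comp (g := fun p : ℝ × (Fin 3 → ℝ) => axisRotation p.1 p.2)
      (f := fun p : (Fin 3 → ℝ) × ℝ => (p.2, p.1)) continuous_axisRotation (by fun_prop)
  exact Continuous.comp (g := F) hF h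

/-- The integral of a function over the rotations about the third axis. -/
noncomputable def axisAverage (F : (Fin 3 → ℝ) → ℝ) (x : Fin 3 → ℝ) : ℝ :=
  ∫ θ in (0 : ℝ)..2 * Real.pi, F (axisRotation θ x)

namespace IsTracelessFrame
variable {F : (Fin 3 → ℝ) → ℝ}

lemma comp (hF : IsTracelessFrame F) (L : (Fin 3 → ℝ) →ₗ[ℝ] (Fin 3 → ℝ))
    (hL : ∀ x y, L x ⬝ᵥ L y = x ⬝ᵥ y) : IsTracelessFrame (F ∘ L) := by
  refine ⟨hF.continuous.comp L.continuous_of_finiteDimensional,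
    fun c x => by simp [hF.smul c], fun x y z hx hy hz hxy hyz hzx => ?_⟩
  exact hF.frame _ _ _ (by rwa [hL]) (by rwa [hL]) (by rwa [hL]) (by rwa [hL]) (by rwa [hL])
    (by rwa [hL])

lemma apply_neg (hF : IsTracelessFrame F) (x : Fin 3 → ℝ) : F (-x) = F x := by
  simpa using hF.smul (-1) x

lemma continuous_comp_axisRotation (hF : IsTracelessFrame F) (x : Fin 3 → ℝ) :
    Continuous fun θ => F (axisRotation θ x) :=
  Continuous.comp (g := fun p : (Fin 3 → ℝ) × ℝ => F (axisRotation p.2 p.1))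
    (f := fun θ : ℝ => (x, θ)) (continuous_uncurry_comp_axisRotation hF.continuous) (by fun_prop)

lemma average (hF : IsTracelessFrame F) : IsTracelessFrame (axisAverage F) := by
  refine ⟨?_, fun c x => ?_, fun x y z hx hy hz hxy hyz hzx => ?_⟩
  · have h : Continuous (Function.uncurry fun x θ => F (axisRotation θ x)) :=
      continuous_uncurry_comp_axisRotation hF.continuous
    exact intervalIntegral.continuous_parametric_intervalIntegral_of_continuous' h _ _
  · have h : ∀ θ, F (axisRotation θ (c • x)) = c ^ 2 * F (axisRotation θ x) := fun θ => by
      rw [map_smul, hF.smul]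
    unfold axisAverage
    rw [← intervalIntegral.integral_const_mul]
    exact intervalIntegral.integral_congr fun θ _ => h θ
  · have hi : ∀ x, IntervalIntegrable (fun θ => F (axisRotation θ x)) MeasureTheory.volume 0
        (2 * Real.pi) := fun x => (hF.continuous_comp_axisRotation x).intervalIntegrable _ _
    unfold axisAverage
    rw [← intervalIntegral.integral_add (hi x) (hi y),
      ← intervalIntegral.integral_add ((hi x).add (hi y)) (hi z)]
    refine (intervalIntegral.integral_congr fun θ _ => ?_).trans intervalIntegral.integral_zero
    exact (hF.comp _ (axisRotation_dotProduct θ)).frame x y z hx hy hz hxy hyz hzx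

lemma axisAverage_axisRotation (φ : ℝ) (x : Fin 3 → ℝ) :
    axisAverage F (axisRotation φ x) = axisAverage F x := by
  simp only [axisAverage, ← axisRotation_add]
  rw [intervalIntegral.integral_comp_add_right (f := fun θ => F (axisRotation θ x)), zero_add,
    add_comm (2 * Real.pi)]
  have hper : Function.Periodic (fun θ => F (axisRotation θ x)) (2 * Real.pi) := fun θ => by
    simp [axisRotation_apply]
  simpa using hper.intervalIntegral_add_eq φ 0

/-- A frame invariant under the rotations about the third axis is a zonal quadratic form. -/
lemma eq_of_axisRotation_invariant (hF : IsTracelessFrame F)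
    (hrot : ∀ φ x, F (axisRotation φ x) = F x) (x : Fin 3 → ℝ) :
    F x = F ![0, 0, 1] * ((3 * x 2 ^ 2 - x ⬝ᵥ x) / 2) := by
  set c : ℝ → ℝ := fun s => F ![√(1 - s), 0, √s] with hc
  have hF0 : F 0 = 0 := by simpa using hF.smul 0 0
  have hcc : Continuous c := by
    refine hF.continuous.comp (continuous_pi fun i => ?_)
    fin_cases i <;> simp <;> fun_prop
  have hunit : ∀ x : Fin 3 → ℝ, x ⬝ᵥ x = 1 → F x = c (x 2 ^ 2) := by
    have hpos : ∀ x : Fin 3 → ℝ, x ⬝ᵥ x = 1 → 0 ≤ x 2 → F x = c (x 2 ^ 2) := by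
      intro x hx h2
      rw [Matrix.vec3_dotProduct] at hx
      set z : ℂ := ⟨x 0, x 1⟩ with hz
      have hzn : ‖z‖ = √(1 - x 2 ^ 2) := by
        rw [Complex.norm_def, Complex.normSq_apply]
        congr 1
        simp only [hz]
        linarith
      have : x = axisRotation z.arg ![√(1 - x 2 ^ 2), 0, √(x 2 ^ 2)] := by
        rw [← hzn, Real.sqrt_sq h2]
        ext i
        fin_cases i
        · simp [axisRotation_apply, mul_comm, hz]
        · simp [axisRotation_apply, mul_comm, hz]
        · simp [axisRotation_apply]
      rw [this, hrot]
      simp [hc, axisRotation_apply, Real.sqrt_sq h2]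
    intro x hx
    rcases le_total 0 (x 2) with h | h
    · exact hpos x hx h
    · rw [← hF.apply_neg, hpos (-x) (by simpa using hx) (by simpa using h)]
      simp
  have hsum : ∀ a b r : ℝ, 0 ≤ a → 0 ≤ b → 0 ≤ r → a + b + r = 1 → c a + c b + c r = 0 := by
    intro a b r ha hb hr habr
    obtain ⟨L, hL, hLL, hLp⟩ := exists_isometric_involution (p := ![√a, √b, √r])
      (q := ![0, 0, 1]) (by simp [Real.mul_self_sqrt, ha, hb, hr]; linarith)
    have h2 : ∀ y : Fin 3 → ℝ, L y 2 = y ⬝ᵥ ![√a, √b, √r] := by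
      intro y
      rw [← hL, hLp]
      simp [Matrix.vec3_dotProduct (L y)]
    have h := hF.frame (L ![1, 0, 0]) (L ![0, 1, 0]) (L ![0, 0, 1]) (by simp [hL]) (by simp [hL])
      (by simp [hL]) (by simp [hL]) (by simp [hL]) (by simp [hL])
    rw [hunit _ (by simp [hL]), hunit _ (by simp [hL]), hunit _ (by simp [hL]), h2, h2, h2] at h
    simpa [Real.sq_sqrt, ha, hb, hr] using h
  have hc1 : c 1 = F ![0, 0, 1] := by simp [hc]
  have hc0 : c 0 = -(c 1) / 2 := by linarith [hsum 1 0 0 (by simp) le_rfl le_rfl (by norm_num)]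
  have hlin : ∀ s ∈ Set.Icc (0 : ℝ) 1, c s = c 0 + s * (c 1 - c 0) := by
    intro s hs
    have := eq_mul_of_add_of_continuousOn_Icc (d := fun s => c s - c 0)
      (by fun_prop) (fun a b ha hb hab => ?_) hs
    · linarith
    · have h1 := hsum a b (1 - (a + b)) ha hb (by linarith) (by ring)
      have h2 := hsum (a + b) 0 (1 - (a + b)) (by linarith) le_rfl (by linarith) (by ring)
      linarith
  have hxx : 0 ≤ x ⬝ᵥ x := by
    rw [Matrix.vec3_dotProduct]; nlinarith [sq_nonneg (x 0), sq_nonneg (x 1), sq_nonneg (x 2)]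
  rcases hxx.eq_or_lt with h | h
  · have : x = 0 := dotProduct_self_eq_zero.1 h.symm
    simp [this, hF0]
  · have hs := Real.sqrt_pos.2 h
    have hsq := Real.sq_sqrt hxx
    set r := √(x ⬝ᵥ x)
    have hu : (r⁻¹ • x) ⬝ᵥ (r⁻¹ • x) = 1 := by
      simp only [smul_dotProduct, dotProduct_smul, smul_eq_mul, ← hsq]
      field_simp
    have hmem : (r⁻¹ • x) 2 ^ 2 ∈ Set.Icc (0 : ℝ) 1 := by
      refine ⟨sq_nonneg _, ?_⟩
      rw [Matrix.vec3_dotProduct] at hu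
      nlinarith [mul_self_nonneg ((r⁻¹ • x) 0), mul_self_nonneg ((r⁻¹ • x) 1)]
    have hx : F x = r ^ 2 * F (r⁻¹ • x) := by
      rw [← hF.smul, smul_inv_smul₀ hs.ne']
    rw [hx, hunit _ hu, hlin _ hmem, hc0, hc1, ← hsq]
    simp only [Pi.smul_apply, smul_eq_mul]
    field_simp
    ring

end IsTracelessFrame

section LinearFrame

open MeasureTheory

/-- The closed Euclidean unit ball of `ℝ³`. -/
def euclideanBall : Set (Fin 3 → ℝ) := {x | x ⬝ᵥ x ≤ 1}

lemma isCompact_euclideanBall : IsCompact euclideanBall := by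
  have hc : IsClosed euclideanBall :=
    isClosed_le (f := fun x : Fin 3 → ℝ => x ⬝ᵥ x) (by fun_prop) continuous_const
  refine Metric.isCompact_of_isClosed_isBounded hc
    ((Metric.isBounded_closedBall (x := (0 : Fin 3 → ℝ)) (r := 1)).subset fun x hx => ?_)
  rw [mem_closedBall_zero_iff, pi_norm_le_iff_of_nonneg zero_le_one]
  have hx' : x ⬝ᵥ x ≤ 1 := hx
  rw [Matrix.vec3_dotProduct] at hx'
  intro i
  rw [Real.norm_eq_abs, abs_le_one_iff_mul_self_le_one]
  fin_cases i <;> simp <;>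
    nlinarith [mul_self_nonneg (x 0), mul_self_nonneg (x 1), mul_self_nonneg (x 2)]

lemma integrableOn_euclideanBall {h : (Fin 3 → ℝ) → ℝ} (hh : Continuous h) :
    IntegrableOn h euclideanBall :=
  hh.continuousOn.integrableOn_compact isCompact_euclideanBall

lemma measurePreserving_of_isometric {L : (Fin 3 → ℝ) →ₗ[ℝ] (Fin 3 → ℝ)}
    (hL : ∀ x y, L x ⬝ᵥ L y = x ⬝ᵥ y) : MeasurePreserving L volume volume := by
  have hM : (LinearMap.toMatrix' L)ᵀ * LinearMap.toMatrix' L = 1 := by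
    ext i j
    have := hL (Pi.single i 1) (Pi.single j 1)
    simpa [Matrix.mul_apply, LinearMap.toMatrix'_apply, dotProduct, Matrix.one_apply,
      Pi.single_apply, Fin.sum_univ_three, eq_comm] using this
  have hdet : LinearMap.det L * LinearMap.det L = 1 := by
    have := congrArg Matrix.det hM
    simpa [LinearMap.det_toMatrix'] using this
  have h0 : LinearMap.det L ≠ 0 := fun h => by simp [h] at hdet
  have habs : |(LinearMap.det L)⁻¹| = 1 := by
    rw [abs_inv, inv_eq_one]
    rcases mul_self_eq_one_iff.1 hdet with h | h <;> simp [h]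
  refine ⟨L.continuous_of_finiteDimensional.measurable, ?_⟩
  rw [Real.map_linearMap_volume_pi_eq_smul_volume_pi h0, habs]
  simp

lemma setIntegral_euclideanBall_comp {L : (Fin 3 → ℝ) →ₗ[ℝ] (Fin 3 → ℝ)}
    (hL : ∀ x y, L x ⬝ᵥ L y = x ⬝ᵥ y) (h : (Fin 3 → ℝ) → ℝ) :
    ∫ x in euclideanBall, h (L x) = ∫ x in euclideanBall, h x := by
  have hker : LinearMap.ker L = ⊥ := by
    refine LinearMap.ker_eq_bot'.2 fun x hx => ?_
    have := hL x x
    rw [hx] at this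
    exact dotProduct_self_eq_zero.1 (by simpa using this.symm)
  have hpre : L ⁻¹' euclideanBall = euclideanBall := by
    ext x
    simp [euclideanBall, hL]
  have := (measurePreserving_of_isometric hL).setIntegral_preimage_emb
    (LinearMap.isClosedEmbedding_of_injective hker).measurableEmbedding h euclideanBall
  rwa [hpre] at this

/-- The second moment of the zonal quadratic form. -/
noncomputable def zonalMoment : ℝ :=
  ∫ x in euclideanBall, (3 * x 2 ^ 2 - x ⬝ᵥ x) / 2 * x 2 ^ 2

namespace IsTracelessFrame
variable {F : (Fin 3 → ℝ) → ℝ}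

lemma integral_mul_sq_apply_two (hF : IsTracelessFrame F) :
    ∫ x in euclideanBall, F x * x 2 ^ 2 = zonalMoment * F ![0, 0, 1] := by
  have h1 : ∀ θ, ∫ x in euclideanBall, F (axisRotation θ x) * x 2 ^ 2 =
      ∫ x in euclideanBall, F x * x 2 ^ 2 := fun θ => by
    simpa [axisRotation_apply] using
      setIntegral_euclideanBall_comp (axisRotation_dotProduct θ) fun x => F x * x 2 ^ 2
  have hpi : (0 : ℝ) ≤ 2 * Real.pi := by positivity
  have h2 : ∫ θ in (0 : ℝ)..2 * Real.pi, ∫ x in euclideanBall, F (axisRotation θ x) * x 2 ^ 2 =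
      ∫ x in euclideanBall, axisAverage F x * x 2 ^ 2 := by
    have hc : Continuous fun p : ℝ × (Fin 3 → ℝ) => F (axisRotation p.1 p.2) * p.2 2 ^ 2 := by
      have := Continuous.comp (g := fun p : (Fin 3 → ℝ) × ℝ => F (axisRotation p.2 p.1))
        (f := fun p : ℝ × (Fin 3 → ℝ) => (p.2, p.1))
        (continuous_uncurry_comp_axisRotation hF.continuous) (by fun_prop)
      exact Continuous.mul this (by fun_prop)
    have h_int : Integrable (Function.uncurry fun (θ : ℝ) (x : Fin 3 → ℝ) =>
        F (axisRotation θ x) * x 2 ^ 2)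
        ((volume.restrict (Set.Ioc 0 (2 * Real.pi))).prod (volume.restrict euclideanBall)) := by
      rw [Measure.prod_restrict]
      have : IntegrableOn (fun p : ℝ × (Fin 3 → ℝ) => F (axisRotation p.1 p.2) * p.2 2 ^ 2)
          (Set.Icc 0 (2 * Real.pi) ×ˢ euclideanBall) (volume.prod volume) :=
        hc.continuousOn.integrableOn_compact (isCompact_Icc.prod isCompact_euclideanBall)
      exact this.mono_set (Set.prod_mono Set.Ioc_subset_Icc_self subset_rfl)
    rw [intervalIntegral.integral_of_le hpi, integral_integral_swap h_int]
    refine integral_congr_ae (ae_of_all _ fun x => ?_)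
    simp only [axisAverage]
    rw [← intervalIntegral.integral_mul_const, intervalIntegral.integral_of_le hpi]
  have h3 : axisAverage F ![0, 0, 1] = 2 * Real.pi * F ![0, 0, 1] := by
    simp [axisAverage, axisRotation_apply]
  have h4 : ∀ x, axisAverage F x = 2 * Real.pi * F ![0, 0, 1] * ((3 * x 2 ^ 2 - x ⬝ᵥ x) / 2) :=
    fun x => by
      rw [← h3]
      exact hF.average.eq_of_axisRotation_invariant axisAverage_axisRotation x
  simp only [h1, h4, intervalIntegral.integral_const, sub_zero, smul_eq_mul] at h2
  have h5 : ∫ x in euclideanBall, 2 * Real.pi * F ![0, 0, 1] * ((3 * x 2 ^ 2 - x ⬝ᵥ x) / 2) * x 2 ^ 2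
      = 2 * Real.pi * F ![0, 0, 1] * zonalMoment := by
    rw [zonalMoment, ← integral_const_mul]
    simp only [mul_assoc]
  rw [h5] at h2
  refine mul_left_cancel₀ (show 2 * Real.pi ≠ 0 by positivity) ?_
  linear_combination h2

lemma integral_mul_sq_dotProduct (hF : IsTracelessFrame F) {p : Fin 3 → ℝ} (hp : p ⬝ᵥ p = 1) :
    ∫ x in euclideanBall, F x * (p ⬝ᵥ x) ^ 2 = zonalMoment * F p := by
  obtain ⟨L, hL, hLL, hLp⟩ := exists_isometric_involution (p := ![0, 0, 1]) (q := p)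
    (by simp [hp])
  have h := (hF.comp L hL).integral_mul_sq_apply_two
  simp only [Function.comp_apply, hLp] at h
  rw [← h, ← setIntegral_euclideanBall_comp hL]
  congr with x
  rw [← hLp, hL, Matrix.vec3_dotProduct]
  simp

end IsTracelessFrame

lemma zonalMoment_pos : 0 < zonalMoment := by
  have hF : IsTracelessFrame fun x => x 2 ^ 2 - x 0 ^ 2 := by
    refine ⟨by fun_prop, fun c x => by simp; ring, fun x y z hx hy hz hxy hyz hzx => ?_⟩
    have hA : (Matrix.of ![x, y, z]) * (Matrix.of ![x, y, z])ᵀ = 1 := by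
      ext i j
      have h : (Matrix.of ![x, y, z] * (Matrix.of ![x, y, z])ᵀ) i j =
        ![x, y, z] i ⬝ᵥ ![x, y, z] j := rfl
      rw [h]
      fin_cases i <;> fin_cases j <;>
        simp [hx, hy, hz, hxy, hyz, hzx, dotProduct_comm y x, dotProduct_comm z y,
          dotProduct_comm x z]
    have hB := mul_eq_one_comm.1 hA
    have h0 := congrFun (congrFun hB 0) 0
    have h2 := congrFun (congrFun hB 2) 2
    simp [Matrix.mul_apply, Fin.sum_univ_three] at h0 h2
    linarith
  have h2 := hF.integral_mul_sq_dotProduct (p := ![0, 0, 1]) (by simp)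
  have h0 := hF.integral_mul_sq_dotProduct (p := ![1, 0, 0]) (by simp)
  have hd : ∫ x in euclideanBall, (x 2 ^ 2 - x 0 ^ 2) ^ 2 = 2 * zonalMoment := by
    have e2 : ∀ x : Fin 3 → ℝ, ![0, 0, 1] ⬝ᵥ x = x 2 := fun x => by
      rw [Matrix.vec3_dotProduct]; simp
    have e0 : ∀ x : Fin 3 → ℝ, ![1, 0, 0] ⬝ᵥ x = x 0 := fun x => by
      rw [Matrix.vec3_dotProduct]; simp
    simp only [e2, e0] at h2 h0
    have : ∫ x in euclideanBall, (x 2 ^ 2 - x 0 ^ 2) ^ 2 =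
        (∫ x in euclideanBall, (x 2 ^ 2 - x 0 ^ 2) * x 2 ^ 2) -
          ∫ x in euclideanBall, (x 2 ^ 2 - x 0 ^ 2) * x 0 ^ 2 := by
      rw [← integral_sub (integrableOn_euclideanBall (by fun_prop))
        (integrableOn_euclideanBall (by fun_prop))]
      congr with x
      ring
    rw [this, h2, h0]
    simp
    ring
  have hpos : 0 < ∫ x in euclideanBall, (x 2 ^ 2 - x 0 ^ 2) ^ 2 := by
    rw [setIntegral_pos_iff_support_of_nonneg_ae (ae_of_all _ fun x => sq_nonneg _)
      (integrableOn_euclideanBall (by fun_prop))]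
    have hopen : IsOpen {x : Fin 3 → ℝ | x ⬝ᵥ x < 1 ∧ x 0 ^ 2 < x 2 ^ 2} :=
      IsOpen.and (isOpen_lt (by fun_prop) (by fun_prop)) (isOpen_lt (by fun_prop) (by fun_prop))
    refine (hopen.measure_pos volume ⟨![0, 0, 1 / 2], by simp; norm_num⟩).trans_le
      (measure_mono fun x hx => ⟨?_, hx.1.le⟩)
    have : 0 < x 2 ^ 2 - x 0 ^ 2 := sub_pos.2 hx.2
    exact (pow_pos this 2).ne'
  linarith

lemma IsTracelessFrame.exists_matrix {F : (Fin 3 → ℝ) → ℝ} (hF : IsTracelessFrame F) :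
    ∃ M : Matrix (Fin 3) (Fin 3) ℝ, ∀ x, F x = x ⬝ᵥ M *ᵥ x := by
  refine ⟨Matrix.of fun i j => zonalMoment⁻¹ * ∫ x in euclideanBall, F x * x i * x j, fun p => ?_⟩
  have hc := hF.continuous
  have key : ∀ p : Fin 3 → ℝ, p ⬝ᵥ (Matrix.of fun i j => zonalMoment⁻¹ *
      ∫ x in euclideanBall, F x * x i * x j) *ᵥ p =
      zonalMoment⁻¹ * ∫ x in euclideanBall, F x * (p ⬝ᵥ x) ^ 2 := by
    intro p
    have : ∀ x, F x * (p ⬝ᵥ x) ^ 2 = ∑ i, ∑ j, p i * p j * (F x * x i * x j) := fun x => by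
      simp only [dotProduct, Fin.sum_univ_three]; ring
    simp only [this]
    rw [integral_finsetSum _ fun i _ => ?_]
    · have hj : ∀ i, ∫ x in euclideanBall, ∑ j, p i * p j * (F x * x i * x j) =
          ∑ j, p i * p j * ∫ x in euclideanBall, F x * x i * x j := fun i => by
        rw [integral_finsetSum _ fun j _ => integrableOn_euclideanBall (by fun_prop)]
        simp only [integral_const_mul]
      simp only [hj]
      simp only [dotProduct, Matrix.mulVec, Matrix.of_apply, Fin.sum_univ_three]
      ring
    · exact integrableOn_euclideanBall (by fun_prop)
  rw [key]
  rcases eq_or_ne p 0 with rfl | hp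
  · simpa using hF.smul 0 0
  · have hpp : 0 < p ⬝ᵥ p := lt_of_le_of_ne
      (Finset.sum_nonneg fun i _ => mul_self_nonneg _)
      (fun h => hp (dotProduct_self_eq_zero.1 h.symm))
    have hs := Real.sqrt_pos.2 hpp
    have hsq := Real.sq_sqrt hpp.le
    set r := √(p ⬝ᵥ p)
    have hu : (r⁻¹ • p) ⬝ᵥ (r⁻¹ • p) = 1 := by
      simp only [smul_dotProduct, dotProduct_smul, smul_eq_mul, ← hsq]
      field_simp
    have h := hF.integral_mul_sq_dotProduct hu
    rw [hF.smul] at h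
    have h' : ∫ x in euclideanBall, F x * (r⁻¹ • p ⬝ᵥ x) ^ 2 =
        r⁻¹ ^ 2 * ∫ x in euclideanBall, F x * (p ⬝ᵥ x) ^ 2 := by
      rw [← integral_const_mul]
      congr with x
      simp only [smul_dotProduct, smul_eq_mul]
      ring
    rw [h'] at h
    have hz := zonalMoment_pos
    field_simp at h ⊢
    linarith

/-- A nonnegative frame function on `ℝ³` is given by a quadratic form. -/
lemma IsFrameFunction.exists_matrix {g : (Fin 3 → ℝ) → ℝ} {w : ℝ} (hg : IsFrameFunction g w)
    (h0 : ∀ x, 0 ≤ g x) :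
    ∃ M : Matrix (Fin 3) (Fin 3) ℝ, ∀ x, (x ⬝ᵥ x) * g x = x ⬝ᵥ M *ᵥ x := by
  have hbd : ∀ x, x ≠ 0 → g x ≤ w := by
    intro x hx
    obtain ⟨y, hy, hyx, -⟩ := IsFrameFunction.exists_ne_zero_dotProduct_eq_zero x x
    obtain ⟨z, hz, hzx, hzy⟩ := IsFrameFunction.exists_ne_zero_dotProduct_eq_zero x y
    linarith [hg.frame x y z hx hy hz (by rwa [dotProduct_comm]) (by rwa [dotProduct_comm]) hzx,
      h0 y, h0 z]
  have hF : IsTracelessFrame fun x => (x ⬝ᵥ x) * (g x - w / 3) := by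
    refine ⟨continuous_iff_continuousAt.2 fun x => ?_, fun c x => ?_,
      fun x y z hx hy hz hxy hyz hzx => ?_⟩
    · rcases eq_or_ne x 0 with rfl | hx
      · have hb : ∀ x, |x ⬝ᵥ x * (g x - w / 3)| ≤ x ⬝ᵥ x * (w + |w / 3|) := fun x => by
          rcases eq_or_ne x 0 with rfl | hx
          · simp
          · have hxx : 0 ≤ x ⬝ᵥ x := Finset.sum_nonneg fun i _ => mul_self_nonneg _
            rw [abs_mul, abs_of_nonneg hxx]
            refine mul_le_mul_of_nonneg_left ((abs_sub _ _).trans ?_) hxx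
            rw [abs_of_nonneg (h0 x)]
            linarith [hbd x hx]
        have hlim : Tendsto (fun x : Fin 3 → ℝ => x ⬝ᵥ x * (w + |w / 3|)) (𝓝 0) (𝓝 0) := by
          have : Continuous fun x : Fin 3 → ℝ => x ⬝ᵥ x * (w + |w / 3|) := by fun_prop
          simpa using this.tendsto 0
        simpa [ContinuousAt] using squeeze_zero_norm hb hlim
      · exact ContinuousAt.mul (by fun_prop) ((hg.continuousAt h0 hx).sub continuousAt_const)
    · rcases eq_or_ne c 0 with rfl | hc
      · simp
      · rw [hg.smul c hc]
        simp only [smul_dotProduct, dotProduct_smul, smul_eq_mul]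
        ring
    · have hne : ∀ x : Fin 3 → ℝ, x ⬝ᵥ x = 1 → x ≠ 0 := by
        rintro _ h rfl
        simp at h
      have := hg.frame x y z (hne x hx) (hne y hy) (hne z hz) hxy hyz hzx
      simp only [hx, hy, hz]
      linarith
  obtain ⟨M, hM⟩ := hF.exists_matrix
  refine ⟨M + Matrix.diagonal fun _ => w / 3, fun x => ?_⟩
  have h1 := hM x
  rw [Matrix.add_mulVec, dotProduct_add, ← h1]
  have : x ⬝ᵥ (Matrix.diagonal fun _ => w / 3) *ᵥ x = (x ⬝ᵥ x) * (w / 3) := by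
    simp [dotProduct, Fin.sum_univ_three, Matrix.mulVec_diagonal]
    ring
  rw [this]
  ring

end LinearFrame

section Hermitian

variable {H : Type*} [NormedAddCommGroup H] [InnerProductSpace ℂ H]

lemma polar_add_of_parallelogram {H : Type*} [AddCommGroup H] {F : H → ℝ} (hneg : ∀ x, F (-x) = F x)
    (hpar : ∀ x y, F (x + y) + F (x - y) = 2 * F x + 2 * F y) (x y z : H) :
    F (x + y + z) - F (x + y - z) = (F (x + z) - F (x - z)) + (F (y + z) - F (y - z)) := by
  have h1 := hpar (x + z) y
  have h2 := hpar (x - z) y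
  have h3 := hpar (y + z) x
  have h4 := hpar (y - z) x
  rw [show x + z + y = x + y + z by abel] at h1
  rw [show x - z + y = x + y - z by abel] at h2
  rw [show y + z + x = x + y + z by abel, ← hneg (y + z - x),
    show -(y + z - x) = x - z - y by abel] at h3
  rw [show y - z + x = x + y - z by abel, ← hneg (y - z - x),
    show -(y - z - x) = x + z - y by abel] at h4
  linarith

/-- Functions homogeneous of degree two that satisfy the parallelogram law and whose polarization
is homogeneous over the reals. -/
structure IsHermitianForm (F : H → ℝ) : Prop where
  smul : ∀ (c : ℂ) x, F (c • x) = ‖c‖ ^ 2 * F x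
  parallelogram : ∀ x y, F (x + y) + F (x - y) = 2 * F x + 2 * F y
  polar_smul : ∀ (t : ℝ) x y,
    F ((t : ℂ) • x + y) - F ((t : ℂ) • x - y) = t * (F (x + y) - F (x - y))

namespace IsHermitianForm
variable {F : H → ℝ}

lemma apply_neg (hF : IsHermitianForm F) (x : H) : F (-x) = F x := by
  simpa using hF.smul (-1) x

lemma apply_sub_comm (hF : IsHermitianForm F) (x y : H) : F (x - y) = F (y - x) := by
  rw [← hF.apply_neg, neg_sub]

lemma apply_I_smul (hF : IsHermitianForm F) (x : H) : F (Complex.I • x) = F x := by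
  simpa using hF.smul Complex.I x

lemma polar_add (hF : IsHermitianForm F) (x y z : H) : F (x + y + z) - F (x + y - z) =
    (F (x + z) - F (x - z)) + (F (y + z) - F (y - z)) :=
  polar_add_of_parallelogram hF.apply_neg hF.parallelogram x y z

/-- The real part of the sesquilinear form, up to a factor. -/
def polar (F : H → ℝ) (x y : H) : ℝ := F (x + y) - F (x - y)

lemma polar_comm (hF : IsHermitianForm F) (x y : H) : polar F x y = polar F y x := by
  rw [polar, polar, add_comm, hF.apply_sub_comm]

lemma polar_add_left (hF : IsHermitianForm F) (x y z : H) :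
    polar F (x + y) z = polar F x z + polar F y z := hF.polar_add x y z

lemma polar_add_right (hF : IsHermitianForm F) (x y z : H) :
    polar F x (y + z) = polar F x y + polar F x z := by
  rw [hF.polar_comm, hF.polar_add_left, hF.polar_comm y, hF.polar_comm z]

lemma polar_smul_left (hF : IsHermitianForm F) (t : ℝ) (x y : H) :
    polar F ((t : ℂ) • x) y = t * polar F x y := hF.polar_smul t x y

lemma polar_smul_right (hF : IsHermitianForm F) (t : ℝ) (x y : H) :
    polar F x ((t : ℂ) • y) = t * polar F x y := by
  rw [hF.polar_comm, hF.polar_smul_left, hF.polar_comm]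

lemma polar_I_smul_I_smul (hF : IsHermitianForm F) (x y : H) :
    polar F (Complex.I • x) (Complex.I • y) = polar F x y := by
  rw [polar, ← smul_add, ← smul_sub, hF.apply_I_smul, hF.apply_I_smul, polar]

lemma polar_neg_right (hF : IsHermitianForm F) (x y : H) :
    polar F x (-y) = - polar F x y := by
  simpa using hF.polar_smul_right (-1) x y

lemma polar_I_smul_left (hF : IsHermitianForm F) (x y : H) :
    polar F (Complex.I • x) y = - polar F x (Complex.I • y) := by
  rw [← hF.polar_I_smul_I_smul x, smul_smul, Complex.I_mul_I, neg_one_smul, hF.polar_neg_right,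
    neg_neg]

lemma smul_eq_re_add_im (c : ℂ) (x : H) :
    c • x = (c.re : ℂ) • x + (c.im : ℂ) • Complex.I • x := by
  rw [smul_smul, ← add_smul, Complex.re_add_im]

lemma polar_complex_smul_right (hF : IsHermitianForm F) (c : ℂ) (x y : H) :
    polar F x (c • y) = c.re * polar F x y + c.im * polar F x (Complex.I • y) := by
  rw [smul_eq_re_add_im, hF.polar_add_right, hF.polar_smul_right, hF.polar_smul_right]

lemma polar_complex_smul_left (hF : IsHermitianForm F) (c : ℂ) (x y : H) :
    polar F (c • x) y = c.re * polar F x y - c.im * polar F x (Complex.I • y) := by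
  rw [smul_eq_re_add_im, hF.polar_add_left, hF.polar_smul_left, hF.polar_smul_left,
    hF.polar_I_smul_left]
  ring

lemma exists_sesquilinear (hF : IsHermitianForm F) :
    ∃ B : H →ₗ⋆[ℂ] H →ₗ[ℂ] ℂ, ∀ x, B x x = F x := by
  have hII : ∀ x y : H, polar F x (Complex.I • Complex.I • y) = - polar F x y := fun x y => by
    rw [smul_smul, Complex.I_mul_I, neg_one_smul, hF.polar_neg_right]
  refine ⟨LinearMap.mk₂'ₛₗ _ _
    (fun x y => (⟨polar F x y / 4, - polar F x (Complex.I • y) / 4⟩ : ℂ)) ?_ ?_ ?_ ?_, ?_⟩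
  · intro x y z
    apply Complex.ext <;> simp only [hF.polar_add_left, Complex.add_re, Complex.add_im] <;> ring
  · intro c x y
    apply Complex.ext <;>
      simp [hF.polar_complex_smul_left, hII] <;> ring
  · intro x y z
    apply Complex.ext <;>
      simp only [smul_add, hF.polar_add_right, Complex.add_re, Complex.add_im] <;> ring
  · intro c x y
    apply Complex.ext <;>
      simp [smul_comm Complex.I c, hF.polar_complex_smul_right c, hII] <;> ring
  · intro x
    have h1 : polar F x x = 4 * F x := by
      have := hF.smul 2 x
      have h0 := hF.smul 0 x
      simp at this h0
      rw [polar, sub_self, h0, ← two_smul ℂ x, this]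
      norm_num
    have h2 : polar F x (Complex.I • x) = 0 := by
      have := hF.polar_I_smul_left x x
      rw [hF.polar_comm] at this
      linarith
    apply Complex.ext <;> simp [h1, h2]

end IsHermitianForm

/-- Degree two homogeneous functions that are quadratic forms on each real three-dimensional space
spanned by orthogonal vectors. -/
structure IsLocallyQuadratic (F : H → ℝ) : Prop where
  smul : ∀ (c : ℂ) x, F (c • x) = ‖c‖ ^ 2 * F x
  exists_matrix : ∀ x y z : H, inner ℂ x y = 0 → inner ℂ x z = 0 → inner ℂ y z = 0 →
    ∃ M : Matrix (Fin 3) (Fin 3) ℝ, ∀ a : Fin 3 → ℝ,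
      F ((a 0 : ℂ) • x + (a 1 : ℂ) • y + (a 2 : ℂ) • z) = a ⬝ᵥ M *ᵥ a

namespace IsLocallyQuadratic
variable {F : H → ℝ}

lemma apply_neg (hF : IsLocallyQuadratic F) (x : H) : F (-x) = F x := by
  simpa using hF.smul (-1) x

lemma polar_add_of_orthogonal (hF : IsLocallyQuadratic F) {x y e : H} (hxy : inner ℂ x y = 0)
    (hxe : inner ℂ x e = 0) (hye : inner ℂ y e = 0) : F (x + y + e) - F (x + y - e) =
    (F (x + e) - F (x - e)) + (F (y + e) - F (y - e)) := by
  obtain ⟨M, hM⟩ := hF.exists_matrix x y e hxy hxe hye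
  have h1 := hM ![1, 1, 1]
  have h2 := hM ![1, 1, -1]
  have h3 := hM ![1, 0, 1]
  have h4 := hM ![1, 0, -1]
  have h5 := hM ![0, 1, 1]
  have h6 := hM ![0, 1, -1]
  simp [dotProduct, Matrix.mulVec, Fin.sum_univ_three, ← sub_eq_add_neg] at h1 h2 h3 h4 h5 h6
  rw [h1, h2, h3, h4, h5, h6]
  ring

lemma parallelogram_of_orthogonal (hF : IsLocallyQuadratic F) {x e : H} (hxe : inner ℂ x e = 0) :
    F (x + e) + F (x - e) = 2 * F x + 2 * F e := by
  obtain ⟨M, hM⟩ := hF.exists_matrix x e 0 hxe (by simp) (by simp)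
  have h1 := hM ![1, 1, 0]
  have h2 := hM ![1, -1, 0]
  have h3 := hM ![1, 0, 0]
  have h4 := hM ![0, 1, 0]
  simp [dotProduct, Matrix.mulVec, Fin.sum_univ_three, ← sub_eq_add_neg] at h1 h2 h3 h4
  rw [h1, h2, h3, h4]
  ring

lemma polar_smul_of_orthogonal (hF : IsLocallyQuadratic F) {x e : H} (hxe : inner ℂ x e = 0) (t : ℝ) :
    F ((t : ℂ) • x + e) - F ((t : ℂ) • x - e) = t * (F (x + e) - F (x - e)) := by
  obtain ⟨M, hM⟩ := hF.exists_matrix x e 0 hxe (by simp) (by simp)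
  have h1 := hM ![1, 1, 0]
  have h2 := hM ![1, -1, 0]
  have h3 := hM ![t, 1, 0]
  have h4 := hM ![t, -1, 0]
  simp [-Complex.coe_smul, dotProduct, Matrix.mulVec, Fin.sum_univ_three, ← sub_eq_add_neg] at h1 h2 h3 h4
  rw [h1, h2, h3, h4]
  ring

lemma polar_neg (hF : IsLocallyQuadratic F) (x e : H) :
    F (-x + e) - F (-x - e) = -(F (x + e) - F (x - e)) := by
  rw [← hF.apply_neg (-x + e), ← hF.apply_neg (-x - e), show -(-x + e) = x - e by abel,
    show -(-x - e) = x + e by abel]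
  ring

/-- Two vectors can be completed by an orthogonal vector of prescribed norm. -/
lemma exists_orthogonal_norm_eq [FiniteDimensional ℂ H] (hdim : 3 ≤ Module.finrank ℂ H) (x e : H) :
    ∃ f : H, inner ℂ f x = 0 ∧ inner ℂ f e = 0 ∧ ‖f‖ = ‖x‖ := by
  have hlt : Module.finrank ℂ (Submodule.span ℂ {x, e}) < Module.finrank ℂ H := by
    classical
    have := finrank_span_finset_le_card (R := ℂ) ({x, e} : Finset H)
    rw [Finset.coe_pair] at this
    have h2 : ({x, e} : Finset H).card ≤ 2 := Finset.card_le_two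
    rw [Set.finrank] at this
    omega
  have hne : (Submodule.span ℂ {x, e})ᗮ ≠ ⊥ := fun h => by
    rw [Submodule.orthogonal_eq_bot_iff] at h
    rw [h, finrank_top] at hlt
    exact lt_irrefl _ hlt
  obtain ⟨g, hg, hg0⟩ := Submodule.exists_mem_ne_zero_of_ne_bot hne
  rw [Submodule.mem_orthogonal'] at hg
  refine ⟨((‖x‖ / ‖g‖ : ℝ) : ℂ) • g, ?_, ?_, ?_⟩
  · rw [inner_smul_left, hg x (Submodule.subset_span (by simp)), mul_zero]
  · rw [inner_smul_left, hg e (Submodule.subset_span (by simp)), mul_zero]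
  · have := norm_pos_iff.2 hg0
    rw [norm_smul, Complex.norm_real, Real.norm_of_nonneg (by positivity)]
    field_simp

lemma polar_add_smul [FiniteDimensional ℂ H] (hF : IsLocallyQuadratic F)
    (hdim : 3 ≤ Module.finrank ℂ H) {x e : H} (hxe : inner ℂ x e = 0) (ζ : ℂ) :
    F (x + ζ • x + e) - F (x + ζ • x - e) =
      (F (x + e) - F (x - e)) + (F (ζ • x + e) - F (ζ • x - e)) := by
  obtain ⟨f, hfx, hfe, hfn⟩ := exists_orthogonal_norm_eq hdim x e
  have hxf : inner ℂ x f = 0 := inner_eq_zero_symm.1 hfx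
  have hxx : inner ℂ x x = inner ℂ f f := by
    rw [inner_self_eq_norm_sq_to_K, inner_self_eq_norm_sq_to_K, hfn]
  have s := hF.polar_add_of_orthogonal (x := x + f) (y := ζ • (x - f)) (e := e)
    (by rw [inner_smul_right, inner_add_left, inner_sub_right, inner_sub_right, hfx, hxf, hxx]; simp)
    (by simp [hxe, hfe]) (by simp [hxe, hfe])
  have d := hF.polar_add_of_orthogonal (x := x - f) (y := ζ • (x + f)) (e := e)
    (by rw [inner_smul_right, inner_sub_left, inner_add_right, inner_add_right, hfx, hxf, hxx]; simp)
    (by simp [hxe, hfe]) (by simp [hxe, hfe])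
  have split : ∀ a b : ℂ, F (a • x + b • f + e) - F (a • x + b • f - e) =
      (F (a • x + e) - F (a • x - e)) + (F (b • f + e) - F (b • f - e)) := fun a b =>
    hF.polar_add_of_orthogonal (by simp [hxf])
      (by simp [hxe]) (by simp [hfe])
  have s1 := split (1 + ζ) (1 - ζ)
  have s2 := split 1 1
  have s3 := split ζ (-ζ)
  have d1 := split (1 + ζ) (-(1 - ζ))
  have d2 := split 1 (-1)
  have d3 := split ζ ζ
  rw [show x + f + ζ • (x - f) = (1 + ζ) • x + (1 - ζ) • f by module,
    show x + f = (1 : ℂ) • x + (1 : ℂ) • f by module,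
    show ζ • (x - f) = ζ • x + (-ζ) • f by module] at s
  rw [show x - f + ζ • (x + f) = (1 + ζ) • x + (-(1 - ζ)) • f by module,
    show x - f = (1 : ℂ) • x + (-1 : ℂ) • f by module,
    show ζ • (x + f) = ζ • x + ζ • f by module] at d
  have n1 := hF.polar_neg ((1 - ζ) • f) e
  have n2 := hF.polar_neg ((1 : ℂ) • f) e
  have n3 := hF.polar_neg (ζ • f) e
  simp only [← neg_smul] at n1 n2 n3
  rw [show x + ζ • x = (1 + ζ) • x by module]
  rw [show F (x + e) = F ((1 : ℂ) • x + e) by simp, show F (x - e) = F ((1 : ℂ) • x - e) by simp]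
  linarith

lemma exists_eq_smul_add (x y : H) : ∃ (ζ : ℂ) (v : H), y = ζ • x + v ∧ inner ℂ x v = 0 := by
  rcases eq_or_ne x 0 with rfl | hx
  · exact ⟨0, y, by simp, by simp⟩
  · refine ⟨inner ℂ x y / inner ℂ x x, y - (inner ℂ x y / inner ℂ x x) • x, by abel, ?_⟩
    have : inner ℂ x x ≠ 0 := inner_self_ne_zero.2 hx
    rw [inner_sub_right, inner_smul_right]
    field_simp
    ring

lemma isHermitianForm [FiniteDimensional ℂ H] (hF : IsLocallyQuadratic F)
    (hdim : 3 ≤ Module.finrank ℂ H) : IsHermitianForm F := by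
  have formula : ∀ (α : ℂ) (x v : H), inner ℂ x v = 0 → F (α • x + v) =
      ‖α‖ ^ 2 * F x + F v + (F (α • x + v) - F (α • x - v)) / 2 := by
    intro α x v hxv
    have := hF.parallelogram_of_orthogonal (x := α • x) (e := v) (by simp [hxv])
    rw [hF.smul] at this
    linarith
  have hpar : ∀ x y, F (x + y) + F (x - y) = 2 * F x + 2 * F y := by
    intro x y
    obtain ⟨ζ, v, rfl, hxv⟩ := exists_eq_smul_add x y
    have f1 := formula (1 + ζ) x v hxv
    have f2 := formula (1 - ζ) x (-v) (by simp [hxv])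
    have f3 := formula ζ x v hxv
    have p1 := hF.polar_add_smul hdim hxv ζ
    have p2 := hF.polar_add_smul hdim hxv (-ζ)
    have n := hF.polar_neg (ζ • x) v
    simp only [hF.apply_neg, sub_neg_eq_add] at f2
    rw [show x + ζ • x = (1 + ζ) • x by module] at p1
    rw [show x + -ζ • x = (1 - ζ) • x by module, neg_smul, n] at p2
    rw [show x + (ζ • x + v) = (1 + ζ) • x + v by module,
      show x - (ζ • x + v) = (1 - ζ) • x + -v by module]
    have hn : ‖1 + ζ‖ ^ 2 + ‖1 - ζ‖ ^ 2 = 2 + 2 * ‖ζ‖ ^ 2 := by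
      have := parallelogram_law_with_norm ℂ (1 : ℂ) ζ
      simp at this
      nlinarith
    rw [f1, f2, f3, ← sub_eq_add_neg]
    linear_combination F x * hn + p1 / 2 - p2 / 2
  refine ⟨hF.smul, hpar, fun t x y => ?_⟩
  have hadd : ∀ x y z : H, F (x + (y + z)) - F (x - (y + z)) =
      (F (x + y) - F (x - y)) + (F (x + z) - F (x - z)) := by
    intro x y z
    have h := polar_add_of_parallelogram hF.apply_neg hpar y z x
    rwa [← hF.apply_neg (y + z - x), ← hF.apply_neg (y - x), ← hF.apply_neg (z - x), neg_sub,
      neg_sub, neg_sub, add_comm (y + z), add_comm y x, add_comm z x] at h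
  obtain ⟨ζ, v, rfl, hxv⟩ := exists_eq_smul_add x y
  rw [hadd, hadd, hF.polar_smul_of_orthogonal hxv,
    show (t : ℂ) • x + ζ • x = (t + ζ) • x by module,
    show (t : ℂ) • x - ζ • x = (t - ζ) • x by module,
    show x + ζ • x = (1 + ζ) • x by module, show x - ζ • x = (1 - ζ) • x by module]
  simp only [hF.smul, ← Complex.normSq_eq_norm_sq, Complex.normSq_apply]
  simp
  ring

end IsLocallyQuadratic

/-- In dimension at most one homogeneity suffices. -/
lemma isHermitianForm_of_finrank_le_one [FiniteDimensional ℂ H] {F : H → ℝ}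
    (hF : ∀ (c : ℂ) x, F (c • x) = ‖c‖ ^ 2 * F x) (hdim : Module.finrank ℂ H ≤ 1) :
    IsHermitianForm F := by
  obtain ⟨v, hv⟩ := finrank_le_one_iff.1 hdim
  refine ⟨hF, fun x y => ?_, fun t x y => ?_⟩
  all_goals
    obtain ⟨a, rfl⟩ := hv x
    obtain ⟨b, rfl⟩ := hv y
    simp only [smul_smul, ← add_smul, ← sub_smul, hF, ← Complex.normSq_eq_norm_sq,
      Complex.normSq_apply]
    simp
    ring

end Hermitian

section Gleason

open InnerProductSpace

variable {H : Type*} [NormedAddCommGroup H] [InnerProductSpace ℂ H]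

/-- The orthogonal projection onto the line spanned by a vector. -/
noncomputable def lineProj (x : H) : H →L[ℂ] H := ((‖x‖ : ℂ) ^ 2)⁻¹ • rankOne ℂ x x

lemma lineProj_smul {c : ℂ} (hc : c ≠ 0) (x : H) : lineProj (c • x) = lineProj x := by
  have h : (starRingEnd ℂ) c * c = (‖c‖ : ℂ) ^ 2 := Complex.conj_mul' c
  have hn : (‖c‖ : ℂ) ≠ 0 := by simpa using hc
  simp only [lineProj, norm_smul, map_smul, map_smulₛₗ, smul_apply, smul_smul]
  congr 1
  push_cast
  rw [mul_pow, mul_inv, mul_assoc, h]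
  field_simp

lemma lineProj_mul_of_orthogonal {x y : H} (h : inner ℂ x y = 0) :
    lineProj x * lineProj y = 0 := by
  ext z
  simp [lineProj, h]

lemma lineProj_of_norm_eq_one {x : H} (hx : ‖x‖ = 1) : lineProj x = rankOne ℂ x x := by
  simp [lineProj, hx]

/-- The homogeneous extension of a measure restricted to lines. -/
noncomputable def lineForm (μ : (H →L[ℂ] H) → ℝ) (x : H) : ℝ := ‖x‖ ^ 2 * μ (lineProj x)

lemma lineForm_smul (μ : (H →L[ℂ] H) → ℝ) (c : ℂ) (x : H) :
    lineForm μ (c • x) = ‖c‖ ^ 2 * lineForm μ x := by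
  rcases eq_or_ne c 0 with rfl | hc
  · simp [lineForm]
  · rw [lineForm, lineProj_smul hc, norm_smul, lineForm]
    ring

/-- The linear combination of three vectors with real coefficients. -/
noncomputable def realCombination (e : Fin 3 → H) (a : Fin 3 → ℝ) : H := ∑ i, (a i : ℂ) • e i

lemma inner_realCombination {e : Fin 3 → H} (he : Orthonormal ℂ e) (a b : Fin 3 → ℝ) :
    inner ℂ (realCombination e a) (realCombination e b) = ((a ⬝ᵥ b : ℝ) : ℂ) := by
  rw [realCombination, realCombination, he.inner_sum]
  simp [dotProduct]

lemma norm_sq_realCombination {e : Fin 3 → H} (he : Orthonormal ℂ e) (a : Fin 3 → ℝ) :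
    ‖realCombination e a‖ ^ 2 = a ⬝ᵥ a := by
  have := inner_self_eq_norm_sq_to_K (𝕜 := ℂ) (realCombination e a)
  rw [inner_realCombination he] at this
  exact (Complex.ofReal_injective (by simpa using this)).symm

lemma sum_lineProj_realCombination {e : Fin 3 → H} (he : Orthonormal ℂ e) {a : Fin 3 → Fin 3 → ℝ}
    (ha : ∀ k, a k ≠ 0) (hort : ∀ k l, k ≠ l → a k ⬝ᵥ a l = 0) :
    ∑ k, lineProj (realCombination e (a k)) = ∑ i, rankOne ℂ (e i) (e i) := by
  have hpos : ∀ k, a k ⬝ᵥ a k ≠ 0 := fun k h => ha k (dotProduct_self_eq_zero.1 h)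
  have hA : Matrix.of a * Matrix.of (fun i k => a k i / (a k ⬝ᵥ a k)) = 1 := by
    ext k l
    rw [Matrix.mul_apply]
    simp only [Matrix.of_apply, ← mul_div_assoc, ← Finset.sum_div]
    rcases eq_or_ne k l with rfl | h
    · simpa [dotProduct] using div_self (hpos k)
    · have := hort k l h
      simp only [dotProduct] at this
      simp [this, h]
  have hB := mul_eq_one_comm.1 hA
  have hij : ∀ i j, ∑ k, ((a k ⬝ᵥ a k : ℝ) : ℂ)⁻¹ * ((a k i : ℂ) * a k j) =
      if i = j then 1 else 0 := by
    intro i j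
    have := congrFun (congrFun hB i) j
    rw [Matrix.mul_apply, Matrix.one_apply] at this
    simp only [Matrix.of_apply] at this
    rw [← Complex.ofReal_one, ← Complex.ofReal_zero, ← apply_ite Complex.ofReal, ← this,
      Complex.ofReal_sum]
    refine Finset.sum_congr rfl fun k _ => ?_
    push_cast
    ring
  have hexp : ∀ k, lineProj (realCombination e (a k)) = ∑ i, ∑ j,
      (((a k ⬝ᵥ a k : ℝ) : ℂ)⁻¹ * ((a k i : ℂ) * a k j)) • rankOne ℂ (e i) (e j) := by
    intro k
    rw [lineProj, ← Complex.ofReal_pow, norm_sq_realCombination he, realCombination]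
    simp only [map_sum, sum_apply, map_smulₛₗ, smul_apply,
      Finset.smul_sum, smul_smul, Complex.conj_ofReal, RingHom.id_apply]
    rw [Finset.sum_comm]
    refine Finset.sum_congr rfl fun i _ => Finset.sum_congr rfl fun j _ => ?_
    congr 1
    ring
  simp only [hexp]
  rw [Finset.sum_comm]
  refine Finset.sum_congr rfl fun i _ => ?_
  rw [Finset.sum_comm]
  simp only [← Finset.sum_smul, hij]
  simp

lemma exists_orthonormal_smul_eq [FiniteDimensional ℂ H] (hdim : 3 ≤ Module.finrank ℂ H)
    (x : Fin 3 → H) (hx : ∀ i j, i ≠ j → inner ℂ (x i) (x j) = 0) :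
    ∃ e : Fin 3 → H, Orthonormal ℂ e ∧ ∀ i, x i = (‖x i‖ : ℂ) • e i := by
  set v : Fin 3 ⊕ Fin (Module.finrank ℂ H - 3) → H :=
    Sum.elim (fun i => ((‖x i‖⁻¹ : ℝ) : ℂ) • x i) 0 with hv
  have hon : Orthonormal ℂ (Set.domRestrict {i | v i ≠ 0} v) := by
    constructor
    · rintro ⟨i | i, hi⟩
      · have hi' : x i ≠ 0 := fun h => hi (by simp [hv, h])
        have : ‖x i‖ ≠ 0 := norm_ne_zero_iff.2 hi'
        simp only [Set.domRestrict_apply, hv, Sum.elim_inl, norm_smul, Complex.norm_real, norm_inv,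
          norm_norm]
        field_simp
      · exact absurd rfl hi
    · rintro ⟨i | i, hi⟩ ⟨j | j, hj⟩ hij
      · have : i ≠ j := by rintro rfl; exact hij rfl
        simp [hv, inner_smul_left, inner_smul_right, hx i j this]
      all_goals simp [hv]
  obtain ⟨b, hb⟩ := hon.exists_orthonormalBasis_extension_of_card_eq
    (by simp; omega)
  refine ⟨fun i => b (Sum.inl i), b.orthonormal.comp _ Sum.inl_injective, fun i => ?_⟩
  beta_reduce
  rcases eq_or_ne (x i) 0 with h | h
  · simp [h]
  · have hn : (‖x i‖ : ℂ) ≠ 0 := by simpa using h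
    have hvi : v (Sum.inl i) = ((‖x i‖⁻¹ : ℝ) : ℂ) • x i := rfl
    rw [show b (Sum.inl i) = _ from hb (Sum.inl i) (by rw [Set.mem_ofPred_eq, hvi]; simpa using h),
      hvi, smul_smul]
    simp [hn]

variable [CompleteSpace H]

lemma isProjectionOp_lineProj (x : H) : IsProjectionOp (lineProj x) := by
  rcases eq_or_ne x 0 with rfl | hx
  · simp [lineProj, IsProjectionOp, IsIdempotentElem]
  · have hn : ‖x‖ ≠ 0 := norm_ne_zero_iff.2 hx
    have hu : ‖((‖x‖⁻¹ : ℝ) : ℂ) • x‖ = 1 := by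
      rw [norm_smul, Complex.norm_real, Real.norm_of_nonneg (by positivity)]
      field_simp
    rw [← lineProj_smul (c := ((‖x‖⁻¹ : ℝ) : ℂ)) (by simpa using hx), lineProj_of_norm_eq_one hu]
    exact ⟨isIdempotentElem_rankOne_self hu, (isStarProjection_rankOne_self hu).isSelfAdjoint⟩

lemma IsProjectionOp.add {p q : H →L[ℂ] H} (hp : IsProjectionOp p) (hq : IsProjectionOp q)
    (hpq : p * q = 0) (hqp : q * p = 0) : IsProjectionOp (p + q) := by
  refine ⟨?_, hp.2.add hq.2⟩
  rw [IsIdempotentElem, add_mul, mul_add, mul_add, hpq, hqp, hp.1.eq, hq.1.eq]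
  simp

/-- A nonnegative orthoadditive function on projections. -/
structure IsProjectionMeasure (μ : (H →L[ℂ] H) → ℝ) : Prop where
  nonneg : ∀ p, IsProjectionOp p → 0 ≤ μ p
  add : ∀ p q, IsProjectionOp p → IsProjectionOp q → p * q = 0 → q * p = 0 → μ (p + q) = μ p + μ q

namespace IsProjectionMeasure
variable {μ : (H →L[ℂ] H) → ℝ}

lemma isProjectionOp_zero : IsProjectionOp (0 : H →L[ℂ] H) := by
  simp [IsProjectionOp, IsIdempotentElem]

lemma map_zero (hμ : IsProjectionMeasure μ) : μ 0 = 0 := by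
  simpa using hμ.add 0 0 isProjectionOp_zero isProjectionOp_zero (by simp) (by simp)

lemma map_sum_lineProj (hμ : IsProjectionMeasure μ) {ι : Type*} (s : Finset ι) (f : ι → H)
    (hf : ∀ i j, i ≠ j → inner ℂ (f i) (f j) = 0) :
    IsProjectionOp (∑ i ∈ s, lineProj (f i)) ∧
      μ (∑ i ∈ s, lineProj (f i)) = ∑ i ∈ s, μ (lineProj (f i)) := by
  classical
  induction s using Finset.induction_on with
  | empty => simpa using ⟨isProjectionOp_zero, hμ.map_zero⟩
  | insert i s hi ih =>
    have h1 : lineProj (f i) * ∑ j ∈ s, lineProj (f j) = 0 := by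
      rw [Finset.mul_sum]
      exact Finset.sum_eq_zero fun j hj => lineProj_mul_of_orthogonal
        (hf i j (ne_of_mem_of_not_mem hj hi).symm)
    have h2 : (∑ j ∈ s, lineProj (f j)) * lineProj (f i) = 0 := by
      rw [Finset.sum_mul]
      exact Finset.sum_eq_zero fun j hj => lineProj_mul_of_orthogonal
        (hf j i (ne_of_mem_of_not_mem hj hi))
    rw [Finset.sum_insert hi, Finset.sum_insert hi, ← ih.2]
    exact ⟨(isProjectionOp_lineProj _).add ih.1 h1 h2,
      hμ.add _ _ (isProjectionOp_lineProj _) ih.1 h1 h2⟩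

lemma isFrameFunction (hμ : IsProjectionMeasure μ) {e : Fin 3 → H} (he : Orthonormal ℂ e) :
    IsFrameFunction (fun a => μ (lineProj (realCombination e a)))
      (μ (∑ i, rankOne ℂ (e i) (e i))) := by
  refine ⟨fun c hc a => ?_, fun x y z hx hy hz hxy hyz hzx => ?_⟩
  · have : realCombination e (c • a) = (c : ℂ) • realCombination e a := by
      simp [-Complex.coe_smul, realCombination, Finset.smul_sum, smul_smul]
    rw [this, lineProj_smul (by exact_mod_cast hc)]
  · have hort : ∀ k l, k ≠ l → ![x, y, z] k ⬝ᵥ ![x, y, z] l = 0 := by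
      intro k l hkl
      fin_cases k <;> fin_cases l <;>
        simp_all [dotProduct_comm y x, dotProduct_comm z y, dotProduct_comm x z]
    have hne : ∀ k, ![x, y, z] k ≠ 0 := by
      intro k
      fin_cases k <;> simpa
    have h := (hμ.map_sum_lineProj Finset.univ (fun k => realCombination e (![x, y, z] k))
      fun i j hij => by rw [inner_realCombination he, hort i j hij, Complex.ofReal_zero]).2
    rw [sum_lineProj_realCombination he hne hort] at h
    simpa [Fin.sum_univ_three] using h.symm

lemma exists_matrix_of_orthonormal (hμ : IsProjectionMeasure μ) {e : Fin 3 → H}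
    (he : Orthonormal ℂ e) : ∃ M : Matrix (Fin 3) (Fin 3) ℝ, ∀ a,
      lineForm μ (realCombination e a) = a ⬝ᵥ M *ᵥ a := by
  obtain ⟨M, hM⟩ := (hμ.isFrameFunction he).exists_matrix
    fun a => hμ.nonneg _ (isProjectionOp_lineProj _)
  exact ⟨M, fun a => by rw [← hM, lineForm, norm_sq_realCombination he]⟩

end IsProjectionMeasure

namespace IsProjectionMeasure
variable {μ : (H →L[ℂ] H) → ℝ} [FiniteDimensional ℂ H]

lemma isLocallyQuadratic (hμ : IsProjectionMeasure μ) (hdim : 3 ≤ Module.finrank ℂ H) :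
    IsLocallyQuadratic (lineForm μ) := by
  refine ⟨lineForm_smul μ, fun x y z hxy hxz hyz => ?_⟩
  obtain ⟨e, he, hxe⟩ := exists_orthonormal_smul_eq hdim ![x, y, z] (by
    intro k l hkl
    fin_cases k <;> fin_cases l <;>
      simp_all [inner_eq_zero_symm (x := y) (y := x), inner_eq_zero_symm (x := z)])
  obtain ⟨M, hM⟩ := hμ.exists_matrix_of_orthonormal he
  have h0 : x = (‖x‖ : ℂ) • e 0 := hxe 0
  have h1 : y = (‖y‖ : ℂ) • e 1 := hxe 1
  have h2 : z = (‖z‖ : ℂ) • e 2 := hxe 2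
  refine ⟨Matrix.diagonal ![‖x‖, ‖y‖, ‖z‖] * M * Matrix.diagonal ![‖x‖, ‖y‖, ‖z‖], fun a => ?_⟩
  have key := hM ![a 0 * ‖x‖, a 1 * ‖y‖, a 2 * ‖z‖]
  have hc : realCombination e ![a 0 * ‖x‖, a 1 * ‖y‖, a 2 * ‖z‖] =
      (a 0 : ℂ) • x + (a 1 : ℂ) • y + (a 2 : ℂ) • z := by
    conv_rhs => rw [h0, h1, h2]
    simp only [realCombination, Fin.sum_univ_three, smul_smul, Matrix.cons_val, Complex.ofReal_mul]
  rw [← hc, key]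
  simp [dotProduct, Matrix.mulVec, Fin.sum_univ_three, Matrix.mul_apply, Matrix.diagonal_apply]
  ring

lemma isHermitianForm (hμ : IsProjectionMeasure μ) (hdim : Module.finrank ℂ H ≠ 2) :
    IsHermitianForm (lineForm μ) := by
  rcases le_or_gt (Module.finrank ℂ H) 1 with h | h
  · exact isHermitianForm_of_finrank_le_one (lineForm_smul μ) h
  · exact (hμ.isLocallyQuadratic (by omega)).isHermitianForm (by omega)

/-- Gleason's theorem: outside dimension two, a nonnegative orthoadditive function on the
projections is the restriction of a linear functional. -/
theorem exists_linearMap (hμ : IsProjectionMeasure μ) (hdim : Module.finrank ℂ H ≠ 2) :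
    ∃ φ : (H →L[ℂ] H) →ₗ[ℂ] ℂ, ∀ p, IsProjectionOp p → φ p = μ p := by
  obtain ⟨B, hB⟩ := (hμ.isHermitianForm hdim).exists_sesquilinear
  let b := stdOrthonormalBasis ℂ H
  let φ : (H →L[ℂ] H) →ₗ[ℂ] ℂ :=
    ∑ i, B (b i) ∘ₗ (ContinuousLinearMap.apply ℂ H (b i)).toLinearMap
  have hφ : ∀ x : H, ‖x‖ = 1 → φ (rankOne ℂ x x) = μ (rankOne ℂ x x) := by
    intro x hx
    have h1 : φ (rankOne ℂ x x) = B (∑ i, inner ℂ (b i) x • b i) x := by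
      simp [φ, LinearMap.sum_apply]
    rw [h1, b.sum_repr', hB, lineForm, hx, lineProj_of_norm_eq_one hx]
    simp
  refine ⟨φ, fun p hp => ?_⟩
  obtain ⟨hproj, hpeq⟩ := isStarProjection_iff_eq_starProjection_range.1
    (⟨hp.1, hp.2⟩ : IsStarProjection p)
  let c := stdOrthonormalBasis ℂ p.range
  have hc : ∀ i, ‖(c i : H)‖ = 1 := fun i => c.norm_eq_one i
  have hsum : p = ∑ i, lineProj (c i : H) := by
    refine hpeq.trans (c.starProjection_eq_sum_rankOne.trans ?_)
    exact Finset.sum_congr rfl fun i _ => (lineProj_of_norm_eq_one (hc i)).symm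
  have hm := (hμ.map_sum_lineProj Finset.univ (fun i => (c i : H))
    fun i j hij => c.orthonormal.2 hij).2
  rw [← hsum] at hm
  rw [hm, congrArg φ hsum, map_sum, Complex.ofReal_sum]
  refine Finset.sum_congr rfl fun i _ => ?_
  rw [lineProj_of_norm_eq_one (hc i), hφ _ (hc i)]

end IsProjectionMeasure

end Gleason

section Extension

open InnerProductSpace

lemma norm_sq_smul_lineProj {H : Type*} [NormedAddCommGroup H] [InnerProductSpace ℂ H] (x : H) :
    ((‖x‖ : ℂ) ^ 2) • lineProj x = rankOne ℂ x x := by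
  rcases eq_or_ne x 0 with rfl | hx
  · simp
  · have hn : (‖x‖ : ℂ) ≠ 0 := by simpa using hx
    rw [lineProj, smul_smul, mul_inv_cancel₀ (pow_ne_zero _ hn), one_smul]

lemma rankOne_polarization {H : Type*} [NormedAddCommGroup H] [InnerProductSpace ℂ H] (x y : H) :
    rankOne ℂ x y = (1 / 4 : ℂ) • (rankOne ℂ (x + y) (x + y) - rankOne ℂ (x - y) (x - y)
      + Complex.I • rankOne ℂ (x + Complex.I • y) (x + Complex.I • y)
      - Complex.I • rankOne ℂ (x - Complex.I • y) (x - Complex.I • y)) := by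
  simp only [map_add, map_sub, add_apply, sub_apply, map_smulₛₗ, smul_apply, smul_add, smul_sub,
    smul_smul, Complex.conj_I, RingHom.id_apply, Complex.I_mul_I, neg_smul]
  match_scalars <;> ring_nf
  norm_num [Complex.I_sq]

lemma span_isProjectionOp {H : Type*} [NormedAddCommGroup H] [InnerProductSpace ℂ H]
    [CompleteSpace H] [FiniteDimensional ℂ H] :
    Submodule.span ℂ {p : H →L[ℂ] H | IsProjectionOp p} = ⊤ := by
  set S := Submodule.span ℂ {p : H →L[ℂ] H | IsProjectionOp p}
  have h1 : ∀ x : H, rankOne ℂ x x ∈ S := fun x => by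
    rw [← norm_sq_smul_lineProj]
    exact S.smul_mem _ (Submodule.subset_span (isProjectionOp_lineProj x))
  have h2 : ∀ x y : H, rankOne ℂ x y ∈ S := fun x y => by
    rw [rankOne_polarization]
    exact S.smul_mem _ (S.sub_mem (S.add_mem (S.sub_mem (h1 _) (h1 _)) (S.smul_mem _ (h1 _)))
      (S.smul_mem _ (h1 _)))
  refine eq_top_iff.2 fun A _ => ?_
  let b := stdOrthonormalBasis ℂ H
  have hA : A = ∑ i, rankOne ℂ (A (b i)) (b i) := by
    ext y
    conv_lhs => rw [← b.sum_repr' y]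
    simp [sum_apply]
  rw [hA]
  exact S.sum_mem fun i _ => h2 _ _

lemma exists_basis_isProjectionOp (H : Type*) [NormedAddCommGroup H] [InnerProductSpace ℂ H]
    [CompleteSpace H] [FiniteDimensional ℂ H] :
    ∃ b : Module.Basis (Fin (Module.finrank ℂ (H →L[ℂ] H))) ℂ (H →L[ℂ] H),
      ∀ k, IsProjectionOp (b k) := by
  let b := Module.Basis.ofSpan (span_isProjectionOp (H := H)).ge
  have hb : ∀ k, IsProjectionOp (b k) := fun k =>
    Module.Basis.ofSpan_subset (span_isProjectionOp (H := H)).ge (Set.mem_range_self k)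
  have : Fintype _ := FiniteDimensional.fintypeBasisIndex b
  refine ⟨b.reindex (Fintype.equivFinOfCardEq (Module.finrank_eq_card_basis b).symm), fun k => ?_⟩
  rw [Module.Basis.reindex_apply]
  exact hb _

lemma exists_multilinearMap_basis {n : ℕ} {E : Fin n → Type*} [∀ i, AddCommGroup (E i)]
    [∀ i, Module ℂ (E i)] {d : Fin n → ℕ} (b : ∀ i, Module.Basis (Fin (d i)) ℂ (E i))
    (v : (∀ i, Fin (d i)) → ℂ) :
    ∃ M : MultilinearMap ℂ E ℂ, ∀ j, M (fun i => b i (j i)) = v j := by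
  refine ⟨∑ k : (∀ i, Fin (d i)), v k •
    (MultilinearMap.mkPiAlgebra ℂ (Fin n) ℂ).compLinearMap (fun i => (b i).coord (k i)),
    fun j => ?_⟩
  rw [sum_apply, Finset.sum_eq_single j]
  · simp
  · intro k _ hk
    obtain ⟨i, hi⟩ := Function.ne_iff.1 hk
    have : ∏ i, ((b i).repr (b i (j i))) (k i) = 0 :=
      Finset.prod_eq_zero (Finset.mem_univ i) (by simp [hi.symm])
    simpa using Or.inr this
  · simp

lemma IsQuantumMultimeasure.isProjectionMeasure {n : ℕ} {H : Fin n → Type*}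
    [∀ i, NormedAddCommGroup (H i)] [∀ i, InnerProductSpace ℂ (H i)]
    [∀ i, CompleteSpace (H i)] {m : (∀ i, H i →L[ℂ] H i) → ℝ} (hm : IsQuantumMultimeasure m)
    {p : ∀ i, H i →L[ℂ] H i} (hp : ∀ i, IsProjectionOp (p i)) (i : Fin n) :
    IsProjectionMeasure fun q => m (Function.update p i q) := by
  refine ⟨fun q hq => hm.1 _ fun k => ?_, hm.2 p hp i⟩
  rcases eq_or_ne k i with rfl | h
  · simpa using hq
  · simpa [h] using hp k

end Extension

/-- Every positive quantum multi-measure on finite dimensional Hilbert spaces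
(none of dimension 2) extends uniquely to a multilinear map
`M : B(H₁) × ⋯ × B(Hₙ) → ℂ` agreeing with it on tuples of projections. -/
theorem multimeasure_extends_uniquely_to_multilinear
    {n : ℕ} {H : Fin n → Type*}
    [∀ i, NormedAddCommGroup (H i)] [∀ i, InnerProductSpace ℂ (H i)]
    [∀ i, FiniteDimensional ℂ (H i)]
    (hdim : ∀ i, Module.finrank ℂ (H i) ≠ 2)
    (m : (∀ i, H i →L[ℂ] H i) → ℝ) (hm : IsQuantumMultimeasure m) :
    ∃! M : MultilinearMap ℂ (fun i => H i →L[ℂ] H i) ℂ,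
      ∀ p : ∀ i, H i →L[ℂ] H i, (∀ i, IsProjectionOp (p i)) →
        M p = (m p : ℂ) := by
  choose b hb using fun i => exists_basis_isProjectionOp (H i)
  obtain ⟨M, hM⟩ := exists_multilinearMap_basis b fun j => (m fun i => b i (j i) : ℂ)
  refine ⟨M, ?_, fun M' hM' => Module.Basis.ext_multilinear b fun j => ?_⟩
  · have key : ∀ s : Finset (Fin n), ∀ p : ∀ i, H i →L[ℂ] H i, (∀ i, IsProjectionOp (p i)) →
        (∀ i ∉ s, ∃ k, p i = b i k) → M p = (m p : ℂ) := by
      intro s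
      induction s using Finset.induction_on with
      | empty =>
        intro p _ hk
        choose j hj using fun i => hk i (Finset.notMem_empty i)
        rw [funext hj, hM]
      | insert a s ha ih =>
        intro p hp hk
        obtain ⟨φ, hφ⟩ := (hm.isProjectionMeasure hp a).exists_linearMap (hdim a)
        have heq : M.toLinearMap p a = φ := by
          refine (b a).ext fun k => ?_
          rw [hφ _ (hb a k), MultilinearMap.toLinearMap_apply]
          refine ih _ (fun i => ?_) fun i hi => ?_
          · rcases eq_or_ne i a with rfl | h
            · simpa using hb i k
            · simpa [h] using hp i
          · rcases eq_or_ne i a with rfl | h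
            · exact ⟨k, by simp⟩
            · simpa [h] using hk i (by simp [h, hi])
        have := hφ (p a) (hp a)
        rwa [← heq, MultilinearMap.toLinearMap_apply, Function.update_eq_self] at this
    exact fun p hp => key Finset.univ p hp (by simp)
  · rw [hM, hM' _ fun i => hb i (j i)]
end

section
/- Let M : B(H₁) × ⋯ × B(Hₙ) → ℂ be a bounded multilinear map that takes nonnegative real values on all n-tuples of projections. Then M(x₁,…,xₙ) ≥ 0 whenever each x_j is a positive operator. -/
open scoped ComplexOrder NNReal

section ProjectionCone

variable {H : Type*} [NormedAddCommGroup H] [InnerProductSpace ℂ H] [CompleteSpace H]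

/-- The support projection of `a`: it fixes `a` from the right and annihilates every `b` with
`a * b = 0` from the left. -/
theorem exists_isStarProjection_support (a : H →L[ℂ] H) :
    ∃ p : H →L[ℂ] H, IsStarProjection p ∧ a * p = a ∧ ∀ b, a * b = 0 → p * b = 0 := by
  have hclosed : IsClosed (a.ker : Set H) := a.isClosed_ker
  have : CompleteSpace a.ker := hclosed.completeSpace_coe
  refine ⟨1 - a.ker.starProjection, isStarProjection_starProjection.one_sub, ?_, ?_⟩
  · ext v
    have hv : a (a.ker.starProjection v) = 0 := a.ker.starProjection_apply_mem v
    simp [hv]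
  · intro b hb
    ext v
    have hv : b v ∈ a.ker := congr($hb v)
    simp [Submodule.starProjection_eq_self_iff.2 hv]

/-- For `0 ≤ x ≤ 2r`, the projection `p` is the support of the positive part of `x - r`. -/
theorem exists_isStarProjection_sub_smul_mem_Icc {x : H →L[ℂ] H} {r : ℝ≥0} (hx : 0 ≤ x)
    (hxr : x ≤ (2 * r) • 1) :
    ∃ p : H →L[ℂ] H, IsStarProjection p ∧ 0 ≤ x - r • p ∧ x - r • p ≤ r • 1 := by
  set a : H →L[ℂ] H := x - r • 1 with ha
  have hasa : IsSelfAdjoint a :=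
    (IsSelfAdjoint.of_nonneg hx).sub (IsSelfAdjoint.of_nonneg
      (smul_nonneg r.2 zero_le_one : 0 ≤ (r : ℝ) • (1 : H →L[ℂ] H)))
  obtain ⟨p, hp, hap, hker⟩ := exists_isStarProjection_support a⁺
  have hsub : a⁺ - a⁻ = a := CFC.posPart_sub_negPart a hasa
  have hpn : p * a⁻ = 0 := hker _ (CFC.posPart_mul_negPart a)
  have hps := hp.isSelfAdjoint
  have hpa : p * a⁺ = a⁺ := by
    simpa [hps.star_eq, (IsSelfAdjoint.of_nonneg (CFC.posPart_nonneg a)).star_eq]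
      using congr(star $hap)
  have hnp : a⁻ * p = 0 := by
    simpa [hps.star_eq, (IsSelfAdjoint.of_nonneg (CFC.negPart_nonneg a)).star_eq]
      using congr(star $hpn)
  have hpp : p * p = p := hp.isIdempotentElem
  have hx_eq : x = a⁺ - a⁻ + r • 1 := by rw [hsub, ha]; abel
  refine ⟨p, hp, ?_, ?_⟩
  · have hconj : 0 ≤ (1 - p) * x * (1 - p) := hp.one_sub.isSelfAdjoint.conjugate_nonneg hx
    have key : x - r • p = (1 - p) * x * (1 - p) + a⁺ := by
      rw [hx_eq]
      simp only [mul_add, add_mul, mul_sub, sub_mul, mul_one, one_mul, hap, hpa, hpn, hnp, hpp,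
        mul_smul_comm, smul_mul_assoc, zero_mul, smul_sub]
      abel
    rw [key]
    exact add_nonneg hconj (CFC.posPart_nonneg a)
  · have hconj : 0 ≤ p * ((2 * r) • 1 - x) * p :=
      hps.conjugate_nonneg (sub_nonneg.2 hxr)
    have key : r • 1 - (x - r • p) = p * ((2 * r) • 1 - x) * p + a⁻ := by
      rw [hx_eq, two_mul, add_smul]
      simp only [mul_add, add_mul, mul_sub, sub_mul, mul_one, hap, hpa, hpn, hpp,
        mul_smul_comm, smul_mul_assoc, zero_mul]
      abel
    rw [← sub_nonneg, key]
    exact add_nonneg hconj (CFC.negPart_nonneg a)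

theorem exists_mem_span_isStarProjection_sub_mem_Icc (k : ℕ) {x : H →L[ℂ] H} {r : ℝ≥0}
    (hx : 0 ≤ x) (hxr : x ≤ (2 ^ k * r) • 1) :
    ∃ y ∈ Submodule.span ℝ≥0 {p : H →L[ℂ] H | IsStarProjection p},
      0 ≤ x - y ∧ x - y ≤ r • 1 := by
  induction k generalizing x with
  | zero => exact ⟨0, zero_mem _, by simpa using hx, by simpa using hxr⟩
  | succ k ih =>
    rw [pow_succ', mul_assoc] at hxr
    obtain ⟨p, hp, h₀, h₁⟩ := exists_isStarProjection_sub_smul_mem_Icc hx hxr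
    obtain ⟨y, hy, hy₀, hy₁⟩ := ih h₀ h₁
    refine ⟨(2 ^ k * r) • p + y,
      add_mem (Submodule.smul_mem _ _ (Submodule.subset_span hp)) hy, ?_, ?_⟩
    · rwa [← sub_sub]
    · rwa [← sub_sub]

/-- Positive operators are norm limits of nonnegative combinations of projections. -/
theorem mem_closure_span_isStarProjection {x : H →L[ℂ] H} (hx : 0 ≤ x) :
    x ∈ closure (Submodule.span ℝ≥0 {p : H →L[ℂ] H | IsStarProjection p} : Set (H →L[ℂ] H)) := by
  rw [Metric.mem_closure_iff]
  intro ε hε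
  obtain ⟨k, hk⟩ := pow_unbounded_of_one_lt (‖x‖ / (ε / 2)) one_lt_two
  have hxk : x ≤ (2 ^ k * (ε / 2).toNNReal) • (1 : H →L[ℂ] H) := by
    refine (IsSelfAdjoint.of_nonneg hx).le_algebraMap_norm_self.trans ?_
    rw [NNReal.smul_def, ← Algebra.algebraMap_eq_smul_one]
    apply algebraMap_mono
    rw [div_lt_iff₀ (half_pos hε)] at hk
    simpa [Real.coe_toNNReal _ (half_pos hε).le] using hk.le
  obtain ⟨y, hy, h₀, h₁⟩ := exists_mem_span_isStarProjection_sub_mem_Icc k hx hxk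
  refine ⟨y, hy, ?_⟩
  rw [dist_eq_norm]
  rw [NNReal.smul_def, ← Algebra.algebraMap_eq_smul_one, Real.coe_toNNReal _ (half_pos hε).le] at h₁
  exact ((CStarAlgebra.norm_le_iff_le_algebraMap _ (half_pos hε).le h₀).2 h₁).trans_lt
    (half_lt_self hε)

/-- A continuous linear functional that is nonnegative on projections is positive. -/
theorem ContinuousLinearMap.nonneg_of_isStarProjection (f : (H →L[ℂ] H) →L[ℂ] ℂ)
    (hf : ∀ p, IsStarProjection p → 0 ≤ f p) {x : H →L[ℂ] H} (hx : 0 ≤ x) : 0 ≤ f x := by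
  have hclosed : IsClosed {y | 0 ≤ f y} := isClosed_Ici.preimage f.continuous
  refine closure_minimal (fun y hy => ?_) hclosed (mem_closure_span_isStarProjection hx)
  induction hy using Submodule.span_induction with
  | mem p hp => exact hf p hp
  | zero => simp
  | add y z _ _ hy hz => simpa using add_nonneg hy hz
  | smul r y _ hy =>
    have hr : f (r • y) = r • f y := map_smul_of_tower f r y
    rw [Set.mem_ofPred_eq, hr]
    exact smul_nonneg r.2 hy

end ProjectionCone

/-- A bounded (continuous) multilinear map `M : B(H₁) × ⋯ × B(Hₙ) → ℂ` taking
nonnegative real values on every tuple of projections takes nonnegative real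
values on every tuple of positive operators. -/
theorem multilinear_nonneg_on_projections_nonneg_on_positives
    {n : ℕ} {H : Fin n → Type*}
    [∀ i, NormedAddCommGroup (H i)] [∀ i, InnerProductSpace ℂ (H i)]
    [∀ i, CompleteSpace (H i)]
    (M : ContinuousMultilinearMap ℂ (fun i => H i →L[ℂ] H i) ℂ)
    (hM : ∀ p : ∀ i, H i →L[ℂ] H i, (∀ i, IsProjectionOp (p i)) →
      0 ≤ (M p).re ∧ (M p).im = 0)
    (x : ∀ i, H i →L[ℂ] H i) (hx : ∀ i, (x i).IsPositive) :
    0 ≤ (M x).re ∧ (M x).im = 0 := by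
  simp only [IsProjectionOp] at hM
  have hnonneg (z : ℂ) : (0 ≤ z.re ∧ z.im = 0) ↔ 0 ≤ z := by
    rw [Complex.nonneg_iff, eq_comm (a := z.im)]
  simp only [hnonneg] at hM ⊢
  suffices h : ∀ s : Finset (Fin n), ∀ y : ∀ i, H i →L[ℂ] H i,
      (∀ i ∈ s, 0 ≤ y i) → (∀ i ∉ s, IsStarProjection (y i)) → 0 ≤ M y from
    h Finset.univ x (fun i _ => (ContinuousLinearMap.nonneg_iff_isPositive _).2 (hx i)) (by simp)
  intro s
  induction s using Finset.induction_on with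
  | empty =>
    intro y _ hy
    exact hM y fun i => ⟨(hy i (by simp)).isIdempotentElem, (hy i (by simp)).isSelfAdjoint⟩
  | insert j s hj ih =>
    intro y hpos hproj
    have key := (M.toContinuousLinearMap y j).nonneg_of_isStarProjection (x := y j) ?_
      (hpos j (by simp))
    · simpa using key
    · intro p hp
      refine ih (Function.update y j p) (fun i hi => ?_) (fun i hi => ?_)
      · have hij : i ≠ j := fun h => hj (h ▸ hi)
        simpa [hij] using hpos i (by simp [hi])
      · by_cases hij : i = j
        · subst hij
          simpa using hp
        · simpa [hij] using hproj i (by simp [hi, hij])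
end
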